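/- arXiv:0811.4309 — 2 statements merged into one kernel-verified Lean document; each statement's English description precedes it below -/
import Mathlib

section
/- Let k be a field and A = A_q^a a quantum complete intersection all of whose commutators q_{ij} are roots of unity, and assume A is a symmetric k-algebra. Then for all finitely generated left A-modules M and N, the following are equivalent: (i) Ext_A^i(M,N) = 0 for all sufficiently large i; (ii) Ext_A^i(M,N) = 0 for all i > 0; (iii) Ext_A^i(N,M) = 0 for all sufficiently large i; (iv) Ext_A^i(N,M) = 0 for all i > 0. -/
/-!
Ext-symmetry over a symmetric quantum complete intersection whose commutators
are roots of unity (Theorem `symmetrysymmetric` in the paper).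
-/

noncomputable section

open CategoryTheory

/-- The defining relations of the quantum complete intersection `A_q^a`:
`X_i ^ (a i) = 0` and `X_i * X_j = q i j • (X_j * X_i)`. -/
def qciRel (k : Type) [Field k] (c : ℕ) (q : Fin c → Fin c → k) (a : Fin c → ℕ) :
    FreeAlgebra k (Fin c) → FreeAlgebra k (Fin c) → Prop := fun x y =>
  (∃ i, x = FreeAlgebra.ι k i ^ a i ∧ y = 0) ∨
  (∃ i j, x = FreeAlgebra.ι k i * FreeAlgebra.ι k j ∧
    y = q i j • (FreeAlgebra.ι k j * FreeAlgebra.ι k i))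

/-- The quantum complete intersection `A_q^a = k⟨X_1,…,X_c⟩/(X_i^{a_i}, X_iX_j - q_{ij}X_jX_i)`. -/
abbrev QCI (k : Type) [Field k] (c : ℕ) (q : Fin c → Fin c → k) (a : Fin c → ℕ) : Type :=
  RingQuot (qciRel k c q a)

/-- `A` is a symmetric `k`-algebra: there is a trace form `φ` with `φ(ab) = φ(ba)` whose
associated bilinear form `(a,b) ↦ φ(ab)` is nondegenerate. -/
def IsSymmAlg (k A : Type) [Field k] [Ring A] [Algebra k A] : Prop :=
  ∃ φ : A →ₗ[k] k, (∀ x y : A, φ (x * y) = φ (y * x)) ∧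
    (∀ x : A, (∀ y : A, φ (x * y) = 0) → x = 0) ∧
    (∀ y : A, (∀ x : A, φ (x * y) = 0) → y = 0)

/-- `Ext_A^i(M, N) = 0`. -/
def extVanish (A : Type) [Ring A] (M N : Type) [AddCommGroup M] [Module A M]
    [AddCommGroup N] [Module A N] (i : ℕ) : Prop :=
  Subsingleton
    (((Ext ℤ (ModuleCat A) i).obj (Opposite.op (ModuleCat.of A M))).obj (ModuleCat.of A N))

set_option linter.unusedSimpArgs false
set_option linter.unusedSectionVars false

namespace QCIaux

/-! ### Abstract periodic multicomplexes -/

section MC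

variable {c : ℕ} {V : Type} [AddCommGroup V]

/-- total differential of a multicomplex indexed by `Fin c → ℕ` -/
def D (T : Fin c → (Fin c → ℕ) → V →+ V) (F : (Fin c → ℕ) → V) (j : Fin c → ℕ) : V :=
  ∑ i, if 0 < j i then T i (j - Pi.single i 1) (F (j - Pi.single i 1)) else 0

/-- homogeneous of degree n -/
def Hm (n : ℕ) (F : (Fin c → ℕ) → V) : Prop := ∀ j, ∑ i, j i ≠ n → F j = 0

structure IsMC (T : Fin c → (Fin c → ℕ) → V →+ V) : Prop where
  sq : ∀ i j v, T i (j + Pi.single i 1) (T i j v) = 0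
  anti : ∀ i l, i ≠ l → ∀ j v,
    T l (j + Pi.single i 1) (T i j v) + T i (j + Pi.single l 1) (T l j v) = 0

/-- vanishing of cohomology in degree n+1 -/
def HV (T : Fin c → (Fin c → ℕ) → V →+ V) (n : ℕ) : Prop :=
  ∀ F, Hm (n+1) F → (∀ j, D T F j = 0) → ∃ G, Hm n G ∧ ∀ j, D T G j = F j

variable {T : Fin c → (Fin c → ℕ) → V →+ V}

lemma D_add (F G : (Fin c → ℕ) → V) (j) : D T (F + G) j = D T F j + D T G j := by
  unfold D
  rw [← Finset.sum_add_distrib]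
  refine Finset.sum_congr rfl fun i _ => ?_
  split_ifs <;> simp

lemma D_neg (F : (Fin c → ℕ) → V) (j) : D T (-F) j = - D T F j := by
  unfold D
  rw [← Finset.sum_neg_distrib]
  refine Finset.sum_congr rfl fun i _ => ?_
  split_ifs <;> simp

lemma D_sub (F G : (Fin c → ℕ) → V) (j) : D T (F - G) j = D T F j - D T G j := by
  rw [sub_eq_add_neg, D_add, D_neg, sub_eq_add_neg]

lemma sum_sub_single {j : Fin c → ℕ} {i : Fin c} (h : 0 < j i) :
    ∑ l, j l = ∑ l, (j - Pi.single i 1 : Fin c → ℕ) l + 1 := by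
  have : j = (j - Pi.single i 1) + Pi.single i 1 := by
    funext l
    by_cases hl : l = i
    · subst hl; simp; omega
    · simp [hl]
  conv_lhs => rw [this]
  simp only [Pi.add_apply, Finset.sum_add_distrib]
  simp

lemma sub_add_single {j : Fin c → ℕ} {i : Fin c} (h : 0 < j i) :
    (j - Pi.single i 1) + Pi.single i 1 = j := by
  funext l
  by_cases hl : l = i
  · subst hl; simp; omega
  · simp [hl]

lemma Hm_D {n : ℕ} {F : (Fin c → ℕ) → V} (hF : Hm n F) : Hm (n+1) (D T F) := by
  intro j hj
  refine Finset.sum_eq_zero fun i _ => ?_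
  split_ifs with h
  · rw [hF, map_zero]
    have := sum_sub_single h
    omega
  · rfl

lemma Hm_sub {n : ℕ} {F G : (Fin c → ℕ) → V} (hF : Hm n F) (hG : Hm n G) : Hm n (F - G) := by
  intro j hj
  simp [hF j hj, hG j hj]

lemma Hm_add {n : ℕ} {F G : (Fin c → ℕ) → V} (hF : Hm n F) (hG : Hm n G) : Hm n (F + G) := by
  intro j hj
  simp [hF j hj, hG j hj]

lemma Hm_zero {n : ℕ} : Hm n (0 : (Fin c → ℕ) → V) := fun _ _ => rfl

lemma D_zero (j) : D T (0 : (Fin c → ℕ) → V) j = 0 := by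
  unfold D; simp

lemma D_D (hT : IsMC T) (F : (Fin c → ℕ) → V) (j) : D T (D T F) j = 0 := by
  have h1 : D T (D T F) j = ∑ p : Fin c × Fin c,
      if 0 < j p.1 ∧ 0 < (j - Pi.single p.1 1 : Fin c → ℕ) p.2 then
        T p.1 (j - Pi.single p.1 1) (T p.2 (j - Pi.single p.1 1 - Pi.single p.2 1)
          (F (j - Pi.single p.1 1 - Pi.single p.2 1))) else 0 := by
    rw [Fintype.sum_prod_type]
    unfold D
    refine Finset.sum_congr rfl fun i _ => ?_
    split_ifs with h
    · rw [map_sum]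
      refine Finset.sum_congr rfl fun l _ => ?_
      simp only [h, true_and]
      split_ifs <;> simp
    · symm
      refine Finset.sum_eq_zero fun l _ => ?_
      simp [h]
  rw [h1]
  refine Finset.sum_involution (fun p _ => (p.2, p.1)) ?_ ?_ (fun _ _ => Finset.mem_univ _)
    (fun _ _ => rfl)
  · rintro ⟨i, l⟩ -
    dsimp only
    by_cases hil : i = l
    · subst hil
      split_ifs with h
      · have := hT.sq i (j - Pi.single i 1 - Pi.single i 1)
          (F (j - Pi.single i 1 - Pi.single i 1))
        rw [sub_add_single h.2] at this
        rw [this, add_zero]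
      · simp
    · have e : j - Pi.single l 1 - Pi.single i 1 = j - Pi.single i 1 - Pi.single l 1 := by
        funext x; simp; omega
      have c1 : (j - Pi.single i 1 : Fin c → ℕ) l = j l := by
        simp [Pi.single_apply, Ne.symm hil]
      have c2 : (j - Pi.single l 1 : Fin c → ℕ) i = j i := by
        simp [Pi.single_apply, hil]
      rw [c1, c2, e]
      by_cases h : 0 < j i ∧ 0 < j l
      · rw [if_pos h, if_pos h.symm]
        have := hT.anti i l hil (j - Pi.single i 1 - Pi.single l 1)
          (F (j - Pi.single i 1 - Pi.single l 1))
        rw [sub_add_single (by rw [c1]; exact h.2)] at this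
        rw [← e, sub_add_single (by rw [c2]; exact h.1), e] at this
        rw [add_comm]; exact this
      · rw [if_neg h, if_neg (fun h' => h h'.symm), add_zero]
  · rintro ⟨i, l⟩ - h
    dsimp only at h ⊢
    intro he
    have hil : l = i := (Prod.mk.inj he).1
    subst hil
    apply h
    split_ifs with h
    · have := hT.sq l (j - Pi.single l 1 - Pi.single l 1)
          (F (j - Pi.single l 1 - Pi.single l 1))
      rw [sub_add_single h.2] at this
      exact this
    · rfl

/-- shift operator in direction `m` by `d` -/
def sh (d : ℕ) (m : Fin c) (F : (Fin c → ℕ) → V) (j : Fin c → ℕ) : V :=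
  if d ≤ j m then F (j - Pi.single m d) else 0

def Per (d : ℕ) (T : Fin c → (Fin c → ℕ) → V →+ V) : Prop :=
  ∀ i m j, T i (j + Pi.single m d) = T i j

lemma D_sh {d : ℕ} (hp : Per d T) (m : Fin c) (F : (Fin c → ℕ) → V) (j) :
    D T (sh d m F) j = sh d m (D T F) j := by
  unfold sh D
  dsimp only
  split_ifs with h
  · refine Finset.sum_congr rfl fun i _ => ?_
    by_cases him : i = m
    · subst him
      by_cases hd : d < j i
      · have e : j - Pi.single i 1 - Pi.single i d = j - Pi.single i d - Pi.single i 1 := by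
          funext x; simp; omega
        have e2 : j - Pi.single i 1 = (j - Pi.single i d - Pi.single i 1) + Pi.single i d := by
          funext x
          by_cases hx : x = i
          · subst hx; simp; omega
          · simp [hx]
        rw [if_pos (by omega), if_pos (by simp; omega), if_pos (by simp; omega), e]
        conv_lhs => rw [e2, hp]
      · have c0 : ¬ 0 < (j - Pi.single i d : Fin c → ℕ) i := by simp; omega
        rw [if_neg c0]
        split_ifs with h1 h2
        · simp at h2; omega
        · simp
        · rfl
    · have c1 : (j - Pi.single i 1 : Fin c → ℕ) m = j m := by simp [Pi.single_apply, Ne.symm him]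
      have c2 : (j - Pi.single m d : Fin c → ℕ) i = j i := by simp [Pi.single_apply, him]
      rw [c1, c2, if_pos h]
      have e : j - Pi.single i 1 - Pi.single m d = j - Pi.single m d - Pi.single i 1 := by
        funext x; simp; omega
      have e2 : j - Pi.single i 1 = (j - Pi.single m d - Pi.single i 1) + Pi.single m d := by
        funext x
        by_cases hx : x = m
        · subst hx; simp [Pi.single_apply, Ne.symm him]; omega
        · simp [hx]
      rw [e]
      conv_lhs => rw [e2, hp]
  · refine Finset.sum_eq_zero fun i _ => ?_
    split_ifs with h1 h2
    · exfalso; simp [Pi.sub_apply] at h2; omega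
    · simp
    · rfl

lemma Hm_sh {d : ℕ} {m : Fin c} {n : ℕ} {F : (Fin c → ℕ) → V} (hF : Hm n F) :
    Hm (n + d) (sh d m F) := by
  intro j hj
  unfold sh
  split_ifs with h
  · apply hF
    have : j = (j - Pi.single m d) + Pi.single m d := by
      funext l
      by_cases hl : l = m
      · subst hl; simp; omega
      · simp [hl]
    rw [this] at hj
    simp only [Pi.add_apply, Finset.sum_add_distrib] at hj
    simpa using hj
  · rfl

def Box (d m : ℕ) (j : Fin c → ℕ) : Prop := ∀ l : Fin c, l.val < m → j l < d

lemma Box_sub {d m : ℕ} {j : Fin c → ℕ} (h : Box d m j) (x : Fin c → ℕ) : Box d m (j - x) :=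
  fun l hl => lt_of_le_of_lt (by simp) (h l hl)

lemma D_congr {d m : ℕ} {F G : (Fin c → ℕ) → V} (h : ∀ j, Box d m j → F j = G j) (j)
    (hj : Box d m j) : D T F j = D T G j := by
  unfold D
  refine Finset.sum_congr rfl fun i _ => ?_
  rw [h _ (Box_sub hj _)]

def HVB (d m : ℕ) (T : Fin c → (Fin c → ℕ) → V →+ V) (n : ℕ) : Prop :=
  ∀ F, Hm (n+1) F → (∀ j, Box d m j → D T F j = 0) →
    ∃ G, Hm n G ∧ ∀ j, Box d m j → D T G j = F j

lemma Box_succ {d m : ℕ} (hm : m < c) {j : Fin c → ℕ} :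
    Box d (m+1) j ↔ Box d m j ∧ j ⟨m, hm⟩ < d := by
  constructor
  · intro h
    exact ⟨fun l hl => h l (by omega), h _ (by simp)⟩
  · rintro ⟨h1, h2⟩ l hl
    by_cases e : l.val = m
    · have : l = ⟨m, hm⟩ := Fin.ext e
      rw [this]; exact h2
    · exact h1 l (by omega)

/-- un-shift -/
def ush (d : ℕ) (m : Fin c) (F : (Fin c → ℕ) → V) (j : Fin c → ℕ) : V := F (j + Pi.single m d)

lemma Hm_ush {d : ℕ} {m : Fin c} {n : ℕ} {F : (Fin c → ℕ) → V} (hF : Hm (n+d) F) :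
    Hm n (ush d m F) := by
  intro j hj
  apply hF
  simp only [Pi.add_apply, Finset.sum_add_distrib]
  simpa using hj

lemma sh_ush {d : ℕ} {m : Fin c} {F : (Fin c → ℕ) → V} {j : Fin c → ℕ}
    (h : j m < d → F j = 0) : sh d m (ush d m F) j = F j := by
  unfold sh ush
  split_ifs with h1
  · congr 1
    funext l
    by_cases hl : l = m
    · subst hl; simp; omega
    · simp [hl]
  · rw [h (by omega)]

lemma ush_sh {d : ℕ} {m : Fin c} {F : (Fin c → ℕ) → V} {j : Fin c → ℕ} :
    ush d m (sh d m F) j = F j := by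
  unfold sh ush
  simp

lemma Box_add {d m : ℕ} (hm : m < c) {j : Fin c → ℕ} (h : Box d m j) :
    Box d m (j + Pi.single ⟨m, hm⟩ d) := by
  intro l hl
  have : l ≠ ⟨m, hm⟩ := by rintro rfl; simp at hl
  simpa [this] using h l hl


lemma HVB_up' (hT : IsMC T) {d m n : ℕ} (hd : 0 < d) (hp : Per d T) (hm : m < c)
    (h1 : HVB d m T n) (h2 : HVB d m T (n + d - 1)) : HVB d (m+1) T (n + d - 1) := by
  intro F hF hc
  have e0 : n + d - 1 + 1 = n + d := by omega
  rw [e0] at hF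
  set mm : Fin c := ⟨m, hm⟩
  set E := ush d mm (D T F) with hE
  have hEh : Hm (n+1) E := Hm_ush (by have := Hm_D (T := T) hF; rwa [show n + 1 + d = n + d + 1 by omega])
  have hsE : ∀ j, Box d m j → sh d mm E j = D T F j := fun j hj =>
    sh_ush (fun hlt => hc j ((Box_succ hm).2 ⟨hj, hlt⟩))
  have hDE : ∀ j, Box d m j → D T E j = 0 := by
    intro j hj
    have hb := Box_add hm hj
    have : D T (sh d mm E) (j + Pi.single mm d) = 0 := by
      rw [D_congr hsE _ hb, D_D hT]
    rw [D_sh hp] at this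
    have h3 := ush_sh (d := d) (m := mm) (F := D T E) (j := j)
    rw [← h3]; exact this
  obtain ⟨G', hG', hG'E⟩ := h1 E hEh hDE
  have hs := Hm_sh (d := d) (m := mm) hG'
  obtain ⟨G, hG, hGF⟩ := h2 (F - sh d mm G') (by rw [e0]; exact Hm_sub hF hs) (by
    intro j hj
    rw [D_sub, D_sh hp, ← hsE j hj]
    unfold sh
    split_ifs
    · rw [hG'E _ (Box_sub hj _), sub_self]
    · simp)
  refine ⟨G, hG, fun j hj => ?_⟩
  obtain ⟨hj1, hj2⟩ := (Box_succ hm).1 hj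
  rw [hGF j hj1, Pi.sub_apply]
  unfold sh
  rw [if_neg (by simpa [mm] using hj2), sub_zero]

lemma HVB_down (hT : IsMC T) {d m n : ℕ} (hp : Per (d+1) T) (hm : m < c)
    (h1 : HVB (d+1) m T (n + (d+1))) (h2 : HVB (d+1) (m+1) T (n + d)) : HVB (d+1) m T n := by
  intro F hF hc
  set mm : Fin c := ⟨m, hm⟩
  obtain ⟨G, hG, hGF⟩ := h1 (sh (d+1) mm F) (by
      have := Hm_sh (d := d+1) (m := mm) hF
      rwa [show n + (d+1) + 1 = n + 1 + (d + 1) by omega]) (by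
    intro j hj
    rw [D_sh hp]
    unfold sh
    split_ifs
    · exact hc _ (Box_sub hj _)
    · rfl)
  obtain ⟨H, hH, hHG⟩ := h2 G (by rwa [show n + d + 1 = n + (d+1) by omega]) (by
    intro j hj
    obtain ⟨hj1, hj2⟩ := (Box_succ hm).1 hj
    rw [hGF j hj1]
    unfold sh
    rw [if_neg (by simpa [mm] using hj2)])
  set K0 := G - D T H with hK0
  have hK0h : Hm (n + (d+1)) K0 := Hm_sub hG (by
    have := Hm_D (T := T) hH
    rwa [show n + (d+1) = n + d + 1 by omega])
  have hK : ∀ j, Box (d+1) m j → sh (d+1) mm (ush (d+1) mm K0) j = K0 j := fun j hj =>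
    sh_ush (fun hlt => by
      simp only [hK0, Pi.sub_apply]
      rw [hHG j ((Box_succ hm).2 ⟨hj, hlt⟩), sub_self])
  refine ⟨ush (d+1) mm K0, Hm_ush hK0h, fun j hj => ?_⟩
  have hb := Box_add hm hj
  have h3 : D T (sh (d+1) mm (ush (d+1) mm K0)) (j + Pi.single mm (d+1))
      = sh (d+1) mm F (j + Pi.single mm (d+1)) := by
    rw [D_congr hK _ hb, hK0, D_sub, D_D hT, sub_zero, hGF _ hb]
  rw [D_sh hp] at h3
  have e1 := ush_sh (d := d+1) (m := mm) (F := D T (ush (d+1) mm K0)) (j := j)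
  have e2 := ush_sh (d := d+1) (m := mm) (F := F) (j := j)
  rw [← e1, ← e2]; exact h3

lemma HVB_zero {d n : ℕ} : HVB d 0 T n ↔ HV T n := by
  have : ∀ j : Fin c → ℕ, Box d 0 j := fun j l hl => by omega
  simp [HVB, HV, this]

lemma HVB_top {d n : ℕ} (hn : c * d ≤ n) : HVB (d+1) c T n := by
  intro F hF _
  refine ⟨0, Hm_zero, fun j hj => ?_⟩
  rw [D_zero, hF]
  have : ∑ i, j i ≤ ∑ i : Fin c, d := Finset.sum_le_sum fun i _ => by
    have := hj i i.2; omega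
  simp at this
  omega

/-- Main result on periodic multicomplexes: eventual vanishing implies vanishing. -/
theorem HV_all (hT : IsMC T) {d : ℕ} (hp : Per (d+1) T) (h : ∃ n₀, ∀ n ≥ n₀, HV T n) (n : ℕ) :
    HV T n := by
  have up : ∀ m ≤ c, ∃ n₀, ∀ n ≥ n₀, HVB (d+1) m T n := by
    intro m
    induction m with
    | zero => intro _; simpa only [HVB_zero] using h
    | succ m ih =>
      intro hm
      obtain ⟨n₀, h0⟩ := ih (by omega)
      refine ⟨n₀ + d, fun n hn => ?_⟩
      obtain ⟨t, rfl⟩ : ∃ t, n = t + (d+1) - 1 := ⟨n - d, by omega⟩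
      exact HVB_up' hT (by omega) hp (by omega) (h0 _ (by omega)) (h0 _ (by omega))
  have key : ∀ e m, m + e = c → ∀ n, m * d ≤ n → HVB (d+1) m T n := by
    intro e
    induction e with
    | zero => intro m hm n hn; obtain rfl : m = c := by omega
              exact HVB_top hn
    | succ e ih =>
      intro m hm n hn
      obtain ⟨n₀, h0⟩ := up m (by omega)
      have desc : ∀ r n, m * d ≤ n → n₀ ≤ n + r → HVB (d+1) m T n := by
        intro r
        induction r with
        | zero => intro n _ h; exact h0 n (by omega)
        | succ r ihr =>
          intro n hn hr
          exact HVB_down hT hp (by omega) (ihr _ (by omega) (by omega))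
            (ih (m+1) (by omega) _ (by rw [add_mul]; omega))
      exact desc n₀ n hn (by omega)
  exact HVB_zero.1 (key c 0 (by simp) n (by simp))

end MC

end QCIaux

namespace QCIaux

/-! ### Long exact sequences -/
section LES

variable {c : ℕ} {V₁ V₂ V₃ : Type} [AddCommGroup V₁] [AddCommGroup V₂] [AddCommGroup V₃]
  {T₁ : Fin c → (Fin c → ℕ) → V₁ →+ V₁} {T₂ : Fin c → (Fin c → ℕ) → V₂ →+ V₂}
  {T₃ : Fin c → (Fin c → ℕ) → V₃ →+ V₃}

def Inter (T₁ : Fin c → (Fin c → ℕ) → V₁ →+ V₁) (T₂ : Fin c → (Fin c → ℕ) → V₂ →+ V₂)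
    (φ : V₁ →+ V₂) : Prop := ∀ i j v, φ (T₁ i j v) = T₂ i j (φ v)

lemma map_D {φ : V₁ →+ V₂} (h : Inter T₁ T₂ φ) (F : (Fin c → ℕ) → V₁) (j) :
    φ (D T₁ F j) = D T₂ (fun j => φ (F j)) j := by
  unfold D
  rw [map_sum]
  refine Finset.sum_congr rfl fun i _ => ?_
  split_ifs
  · rw [h]
  · simp

lemma Hm_map {φ : V₁ →+ V₂} {n : ℕ} {F : (Fin c → ℕ) → V₁} (h : Hm n F) :
    Hm n (fun j => φ (F j)) := fun j hj => by simp [h j hj]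

lemma lift_surj {ψ : V₂ →+ V₃} (hs : Function.Surjective ψ) {n : ℕ} {F : (Fin c → ℕ) → V₃}
    (hF : Hm n F) : ∃ G : (Fin c → ℕ) → V₂, Hm n G ∧ ∀ j, ψ (G j) = F j := by
  choose g hg using hs
  refine ⟨fun j => if ∑ i, j i = n then g (F j) else 0, fun j hj => by simp [hj], fun j => ?_⟩
  dsimp only
  split_ifs with h
  · exact hg _
  · rw [hF j h, map_zero]

lemma lift_ker {φ : V₁ →+ V₂} {ψ : V₂ →+ V₃} (he : ∀ v, ψ v = 0 → ∃ w, φ w = v)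
    {n : ℕ} {F : (Fin c → ℕ) → V₂} (hF : Hm n F) (h0 : ∀ j, ψ (F j) = 0) :
    ∃ G : (Fin c → ℕ) → V₁, Hm n G ∧ ∀ j, φ (G j) = F j := by
  choose g hg using fun j => he _ (h0 j)
  refine ⟨fun j => if ∑ i, j i = n then g j else 0, fun j hj => by simp [hj], fun j => ?_⟩
  dsimp only
  split_ifs with h
  · exact hg _
  · rw [hF j h, map_zero]

/-- surjectivity on cocycles in degree n -/
def Lift (T₂ : Fin c → (Fin c → ℕ) → V₂ →+ V₂) (T₃ : Fin c → (Fin c → ℕ) → V₃ →+ V₃)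
    (ψ : V₂ →+ V₃) (n : ℕ) : Prop :=
  ∀ F, Hm n F → (∀ j, D T₃ F j = 0) → ∃ G, Hm n G ∧ (∀ j, D T₂ G j = 0) ∧ ∀ j, ψ (G j) = F j

/-- short exact sequence of multicomplexes -/
structure SES (T₁ : Fin c → (Fin c → ℕ) → V₁ →+ V₁) (T₂ : Fin c → (Fin c → ℕ) → V₂ →+ V₂)
    (T₃ : Fin c → (Fin c → ℕ) → V₃ →+ V₃) (φ : V₁ →+ V₂) (ψ : V₂ →+ V₃) : Prop where
  h₁ : Inter T₁ T₂ φ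
  h₂ : Inter T₂ T₃ ψ
  hi : Function.Injective φ
  hs : Function.Surjective ψ
  he : ∀ v, ψ v = 0 → ∃ w, φ w = v
  hz : ∀ v, ψ (φ v) = 0

variable {φ : V₁ →+ V₂} {ψ : V₂ →+ V₃}

lemma SES.les_a (S : SES T₁ T₂ T₃ φ ψ) (hT : IsMC T₂) {n : ℕ} (h : HV T₁ n) :
    Lift T₂ T₃ ψ n := by
  intro F hF hc
  obtain ⟨G, hG, hGF⟩ := lift_surj S.hs hF
  have e : (fun j => ψ (G j)) = F := funext hGF
  obtain ⟨E, hE, hEG⟩ := lift_ker S.he (Hm_D (T := T₂) hG) (fun j => by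
    rw [map_D S.h₂, e, hc])
  have e2 : (fun j => φ (E j)) = D T₂ G := funext hEG
  obtain ⟨K, hK, hKE⟩ := h E hE (fun j => by
    apply S.hi
    rw [map_D S.h₁, e2, D_D hT, map_zero])
  refine ⟨G - fun j => φ (K j), Hm_sub hG (Hm_map hK), fun j => ?_, fun j => ?_⟩
  · rw [D_sub, ← map_D S.h₁, hKE, hEG, sub_self]
  · simp only [Pi.sub_apply, map_sub, hGF, S.hz, sub_zero]

lemma SES.les_b (S : SES T₁ T₂ T₃ φ ψ) {n : ℕ} (hl : Lift T₂ T₃ ψ n) (h : HV T₂ n) :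
    HV T₁ n := by
  intro F hF hc
  obtain ⟨G, hG, hGF⟩ := h _ (Hm_map (φ := φ) hF) (fun j => by rw [← map_D S.h₁, hc, map_zero])
  obtain ⟨K, hK, hKc, hKG⟩ := hl _ (Hm_map (φ := ψ) hG) (fun j => by
    rw [← map_D S.h₂, hGF, S.hz])
  obtain ⟨E, hE, hEG⟩ := lift_ker S.he (Hm_sub hG hK) (fun j => by simp [hKG])
  have e2 : (fun j => φ (E j)) = G - K := funext hEG
  refine ⟨E, hE, fun j => S.hi ?_⟩
  rw [map_D S.h₁, e2, D_sub, hKc, sub_zero, hGF]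

lemma SES.les_c (S : SES T₁ T₂ T₃ φ ψ) (hT : IsMC T₂) {n : ℕ} (h : HV T₃ n) :
    Lift T₂ T₃ ψ (n+1) := by
  intro F hF hc
  obtain ⟨G, hG, hGF⟩ := h F hF hc
  obtain ⟨K, hK, hKG⟩ := lift_surj S.hs hG
  have e : (fun j => ψ (K j)) = G := funext hKG
  exact ⟨D T₂ K, Hm_D hK, fun j => D_D hT _ _, fun j => by rw [map_D S.h₂, e, hGF]⟩

lemma SES.les_d (S : SES T₁ T₂ T₃ φ ψ) {n : ℕ} (hl : Lift T₂ T₃ ψ (n+1)) (h : HV T₂ n) :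
    HV T₃ n := by
  intro F hF hc
  obtain ⟨G, hG, hGc, hGF⟩ := hl F hF hc
  obtain ⟨K, hK, hKG⟩ := h G hG hGc
  exact ⟨_, Hm_map (φ := ψ) hK, fun j => by rw [← map_D S.h₂, hKG, hGF]⟩

lemma SES.les_mid (S : SES T₁ T₂ T₃ φ ψ) (hT : IsMC T₂) {n : ℕ} (h1 : HV T₁ n) (h3 : HV T₃ n) :
    HV T₂ n := by
  intro F hF hc
  obtain ⟨G, hG, hGF⟩ := h3 _ (Hm_map (φ := ψ) hF) (fun j => by rw [← map_D S.h₂, hc, map_zero])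
  obtain ⟨K, hK, hKG⟩ := lift_surj S.hs hG
  have e : (fun j => ψ (K j)) = G := funext hKG
  obtain ⟨E, hE, hEF⟩ := lift_ker S.he (Hm_sub hF (Hm_D (T := T₂) hK)) (fun j => by
    rw [Pi.sub_apply, map_sub, map_D S.h₂, e, hGF, sub_self])
  have e2 : (fun j => φ (E j)) = F - D T₂ K := funext hEF
  obtain ⟨H, hH, hHE⟩ := h1 E hE (fun j => S.hi (by
    rw [map_D S.h₁, e2, D_sub, hc, D_D hT, sub_zero, map_zero]))
  refine ⟨K + fun j => φ (H j), Hm_add hK (Hm_map hH), fun j => ?_⟩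
  rw [D_add, ← map_D S.h₁, hHE, hEF, Pi.sub_apply, add_sub_cancel]

/-- degree zero cocycles -/
def HZ (T : Fin c → (Fin c → ℕ) → V₁ →+ V₁) (v : V₁) : Prop := ∀ i, T i 0 v = 0

def pt (v : V₁) : (Fin c → ℕ) → V₁ := fun j => if j = 0 then v else 0

lemma Hm_pt (v : V₁) : Hm 0 (pt (c := c) v) := by
  intro j hj
  unfold pt
  rw [if_neg]
  rintro rfl
  simp at hj

lemma eq_pt {F : (Fin c → ℕ) → V₁} (hF : Hm 0 F) : F = pt (F 0) := by
  funext j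
  unfold pt
  split_ifs with h
  · rw [h]
  · apply hF
    intro h0
    apply h
    funext i
    simpa using (Finset.sum_eq_zero_iff.1 h0 i (Finset.mem_univ _))

lemma D_pt (v : V₁) : (∀ j, D T₁ (pt v) j = 0) ↔ HZ T₁ v := by
  constructor
  · intro h i
    have := h (Pi.single i 1)
    unfold D at this
    rw [Finset.sum_eq_single i] at this
    · simpa [pt] using this
    · intro l _ hl
      rw [if_neg]; simp [hl]
    · simp
  · intro h j
    refine Finset.sum_eq_zero fun i _ => ?_
    split_ifs with h0
    · unfold pt
      split_ifs with h1
      · rw [h1, h]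
      · simp
    · rfl

lemma Lift_zero {ψ : V₂ →+ V₃} : Lift T₂ T₃ ψ 0 ↔ ∀ v, HZ T₃ v → ∃ w, HZ T₂ w ∧ ψ w = v := by
  constructor
  · intro h v hv
    obtain ⟨G, hG, hGc, hGF⟩ := h (pt v) (Hm_pt v) ((D_pt v).2 hv)
    rw [eq_pt hG, D_pt] at hGc
    exact ⟨G 0, hGc, by simpa [pt] using hGF 0⟩
  · intro h F hF hc
    rw [eq_pt hF, D_pt] at hc
    obtain ⟨w, hw, e⟩ := h _ hc
    refine ⟨pt w, Hm_pt w, (D_pt w).2 hw, fun j => ?_⟩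
    rw [eq_pt hF]
    unfold pt
    split_ifs <;> simp [e]

lemma HV_retract {s : V₁ →+ V₂} {r : V₂ →+ V₁} (hs : Inter T₁ T₂ s) (hr : Inter T₂ T₁ r)
    (h : ∀ v, r (s v) = v) {n : ℕ} (hv : HV T₂ n) : HV T₁ n := by
  intro F hF hc
  obtain ⟨G, hG, hGF⟩ := hv _ (Hm_map (φ := s) hF) (fun j => by rw [← map_D hs, hc, map_zero])
  exact ⟨_, Hm_map (φ := r) hG, fun j => by rw [← map_D hr, hGF, h]⟩

lemma HV_prod {ι : Type} {W : ι → Type} [∀ x, AddCommGroup (W x)]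
    {TW : ∀ x, Fin c → (Fin c → ℕ) → W x →+ W x} (p : ∀ x, V₁ →+ W x)
    (hp : ∀ x, Inter T₁ (TW x) (p x)) (hsurj : ∀ w : (∀ x, W x), ∃ v, ∀ x, p x v = w x)
    (hinj : ∀ v w, (∀ x, p x v = p x w) → v = w) {n : ℕ} (h : ∀ x, HV (TW x) n) : HV T₁ n := by
  intro F hF hc
  choose G hG hGF using fun x => h x _ (Hm_map (φ := p x) hF)
    (fun j => by rw [← map_D (hp x), hc, map_zero])
  choose K hK using fun j => hsurj (fun x => G x j)
  refine ⟨K, fun j hj => hinj _ _ fun x => ?_, fun j => hinj _ _ fun x => ?_⟩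
  · rw [hK, hG x j hj, map_zero]
  · rw [map_D (hp x), ← hGF]
    congr 1
    funext j
    exact hK j x

end LES

/-! ### The multicomplex attached to q-commuting operators -/
section QS

variable {k : Type} [Field k] {c : ℕ}

structure QS (q : Fin c → Fin c → k) (a : Fin c → ℕ) (V : Type) [AddCommGroup V] [Module k V] where
  L : Fin c → Module.End k V
  R : Fin c → Module.End k V
  hL : ∀ i j, L i * L j = q i j • (L j * L i)
  hR : ∀ i j, R i * R j = q j i • (R j * R i)
  hLR : ∀ i j, L i * R j = R j * L i
  hLa : ∀ i, L i ^ a i = 0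
  hRa : ∀ i, R i ^ a i = 0

/-- degree of the p-th differential -/
def dl (a p : ℕ) : ℕ := if Even p then 1 else a - 1

def wt (a p : ℕ) : ℕ := ∑ t ∈ Finset.range p, dl a t

def cf (k : Type) [Field k] (p s : ℕ) : k := if Even p ∧ s = 0 then -1 else 1

def al (q : Fin c → Fin c → k) (a : Fin c → ℕ) (i : Fin c) (j : Fin c → ℕ) : k :=
  ∏ l, if l < i then q l i ^ wt (a l) (j l) else 1

def be (q : Fin c → Fin c → k) (a : Fin c → ℕ) (i : Fin c) (j : Fin c → ℕ) : k :=
  ∏ l, if i < l then q i l ^ wt (a l) (j l) else 1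

def sgn (k : Type) [Field k] (i : Fin c) (j : Fin c → ℕ) : k :=
  ∏ l, if l < i then (-1) ^ (j l) else 1

variable {q : Fin c → Fin c → k} {a : Fin c → ℕ} {V : Type} [AddCommGroup V] [Module k V]

def QS.TT (S : QS q a V) (i : Fin c) (j : Fin c → ℕ) : Module.End k V :=
  sgn k i j • ∑ s ∈ Finset.range (dl (a i) (j i) + 1),
    (cf k (j i) s * al q a i j ^ s * be q a i j ^ (dl (a i) (j i) - s)) •
      (S.L i ^ s * S.R i ^ (dl (a i) (j i) - s))

def QS.T (S : QS q a V) (i : Fin c) (j : Fin c → ℕ) : V →+ V := (S.TT i j).toAddMonoidHom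

lemma QS.T_apply (S : QS q a V) (i : Fin c) (j : Fin c → ℕ) (v : V) : S.T i j v = S.TT i j v := rfl

lemma qpow {A : Type} [Ring A] [Algebra k A] {X Y : A} {z : k} (h : X * Y = z • (Y * X))
    (u s : ℕ) : X ^ u * Y ^ s = z ^ (u * s) • (Y ^ s * X ^ u) := by
  have h1 : ∀ s, X * Y ^ s = z ^ s • (Y ^ s * X) := by
    intro s
    induction s with
    | zero => simp
    | succ s ih =>
      rw [pow_succ, ← mul_assoc, ih, smul_mul_assoc, mul_assoc, h, mul_smul_comm, smul_smul,
        ← pow_succ, mul_assoc]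
  induction u with
  | zero => simp
  | succ u ih =>
    rw [pow_succ, mul_assoc, h1, mul_smul_comm, ← mul_assoc, ih, smul_mul_assoc, smul_smul,
      mul_assoc, ← pow_add]
    congr 2
    ring

lemma prod_upd {f g : Fin c → k} (i : Fin c) (z : k) (h : f i = g i * z)
    (h' : ∀ l, l ≠ i → f l = g l) : ∏ l, f l = (∏ l, g l) * z := by
  rw [← Finset.mul_prod_erase _ _ (Finset.mem_univ i), ← Finset.mul_prod_erase _ g (Finset.mem_univ i),
    h, Finset.prod_congr rfl (fun l hl => h' l (Finset.ne_of_mem_erase hl))]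
  ring

lemma wt_succ (a p : ℕ) : wt a (p+1) = wt a p + dl a p := Finset.sum_range_succ _ _

lemma al_add_lt (i l : Fin c) (h : i < l) (j) :
    al q a l (j + Pi.single i 1) = al q a l j * q i l ^ dl (a i) (j i) := by
  refine prod_upd i _ ?_ ?_
  · simp [h, wt_succ, pow_add]
  · intro x hx; simp [hx]

lemma al_add_ge (i l : Fin c) (h : ¬ i < l) (j) :
    al q a l (j + Pi.single i 1) = al q a l j := by
  refine Finset.prod_congr rfl fun x _ => ?_
  split_ifs with h1
  · have : x ≠ i := by rintro rfl; exact h h1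
    simp [this]
  · rfl

lemma sgn_add_lt (i l : Fin c) (h : i < l) (j) :
    sgn k l (j + Pi.single i 1) = - sgn k l j := by
  rw [← mul_neg_one (sgn k l j)]
  refine prod_upd i _ ?_ ?_
  · simp [h, pow_succ]
  · intro x hx; simp [hx]

lemma sgn_add_ge (i l : Fin c) (h : ¬ i < l) (j) :
    sgn k l (j + Pi.single i 1) = sgn k l j := by
  refine Finset.prod_congr rfl fun x _ => ?_
  split_ifs with h1
  · have : x ≠ i := by rintro rfl; exact h h1
    simp [this]
  · rfl

lemma be_add_lt (i l : Fin c) (h : i < l) (j) :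
    be q a i (j + Pi.single l 1) = be q a i j * q i l ^ dl (a l) (j l) := by
  refine prod_upd l _ ?_ ?_
  · simp [h, wt_succ, pow_add]
  · intro x hx; simp [hx]

lemma be_add_ge (i l : Fin c) (h : ¬ i < l) (j) :
    be q a i (j + Pi.single l 1) = be q a i j := by
  refine Finset.prod_congr rfl fun x _ => ?_
  split_ifs with h1
  · have : x ≠ l := by rintro rfl; exact h h1
    simp [this]
  · rfl

lemma QS.comm4 (S : QS q a V) (i l : Fin c) (u v s t : ℕ) :
    (S.L l ^ u * S.R l ^ v) * (S.L i ^ s * S.R i ^ t)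
      = (q l i ^ (u * s) * q i l ^ (v * t)) • ((S.L i ^ s * S.R i ^ t) * (S.L l ^ u * S.R l ^ v)) := by
  have c1 : S.R l ^ v * S.L i ^ s = S.L i ^ s * S.R l ^ v :=
    (Commute.pow_pow (show Commute (S.R l) (S.L i) from (S.hLR i l).symm) v s)
  have c2 : S.R i ^ t * S.L l ^ u = S.L l ^ u * S.R i ^ t :=
    (Commute.pow_pow (show Commute (S.R i) (S.L l) from (S.hLR l i).symm) t u)
  calc (S.L l ^ u * S.R l ^ v) * (S.L i ^ s * S.R i ^ t)
      = S.L l ^ u * (S.R l ^ v * S.L i ^ s) * S.R i ^ t := by simp only [mul_assoc]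
    _ = (S.L l ^ u * S.L i ^ s) * (S.R l ^ v * S.R i ^ t) := by rw [c1]; simp only [mul_assoc]
    _ = (q l i ^ (u * s) * q i l ^ (v * t)) • ((S.L i ^ s * S.L l ^ u) * (S.R i ^ t * S.R l ^ v)) := by
        rw [qpow (S.hL l i), qpow (S.hR l i), smul_mul_smul_comm]
    _ = (q l i ^ (u * s) * q i l ^ (v * t)) • (S.L i ^ s * (S.L l ^ u * S.R i ^ t) * S.R l ^ v) := by
        simp only [mul_assoc]
    _ = _ := by rw [← c2]; simp only [mul_assoc]

lemma QS.TT_anti (S : QS q a V) (hqc : ∀ i j, q i j * q j i = 1) (i l : Fin c) (hil : i < l) (j) :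
    S.TT l (j + Pi.single i 1) * S.TT i j = - (S.TT i (j + Pi.single l 1) * S.TT l j) := by
  unfold QS.TT
  rw [al_add_lt i l hil, be_add_ge l i (not_lt.2 hil.le), sgn_add_lt i l hil,
    al_add_ge l i (not_lt.2 hil.le), be_add_lt i l hil, sgn_add_ge l i (not_lt.2 hil.le)]
  have e1 : (j + Pi.single i 1 : Fin c → ℕ) l = j l := by simp [hil.ne']
  have e2 : (j + Pi.single l 1 : Fin c → ℕ) i = j i := by simp [hil.ne]
  rw [e1, e2, smul_mul_smul_comm, smul_mul_smul_comm, neg_mul, neg_smul, mul_comm (sgn k l j)]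
  congr 2
  rw [Finset.sum_mul_sum, Finset.sum_mul_sum, Finset.sum_comm]
  refine Finset.sum_congr rfl fun s hs => Finset.sum_congr rfl fun u hu => ?_
  rw [Finset.mem_range] at hs hu
  obtain ⟨t, ht⟩ : ∃ t, dl (a i) (j i) = s + t := ⟨dl (a i) (j i) - s, by omega⟩
  obtain ⟨v, hv⟩ : ∃ v, dl (a l) (j l) = u + v := ⟨dl (a l) (j l) - u, by omega⟩
  rw [ht, hv, Nat.add_sub_cancel_left, Nat.add_sub_cancel_left, smul_mul_smul_comm,
    smul_mul_smul_comm, QS.comm4, smul_smul]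
  congr 1
  have hq : q l i = (q i l)⁻¹ := eq_inv_of_mul_eq_one_right (hqc i l)
  have hq0 : q i l ≠ 0 := left_ne_zero_of_mul_eq_one (hqc i l)
  have key : (q i l ^ (s + t)) ^ u * (q l i ^ (u * s) * q i l ^ (v * t)) = (q i l ^ (u + v)) ^ t := by
    have h1 : q i l ^ (u * s) * q l i ^ (u * s) = 1 := by rw [← mul_pow, hqc, one_pow]
    calc (q i l ^ (s + t)) ^ u * (q l i ^ (u * s) * q i l ^ (v * t))
        = (q i l ^ (u * s) * q l i ^ (u * s)) * (q i l ^ (u + v)) ^ t := by ring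
      _ = _ := by rw [h1, one_mul]
  rw [mul_pow, mul_pow, ← key]
  ring

lemma QS.TT_even (S : QS q a V) {i : Fin c} {j : Fin c → ℕ} (h : Even (j i)) :
    S.TT i j = sgn k i j • (al q a i j • S.L i - be q a i j • S.R i) := by
  unfold QS.TT
  have : dl (a i) (j i) = 1 := by simp [dl, h]
  rw [this, Finset.sum_range_succ, Finset.sum_range_one]
  simp [cf, h]
  rw [← sub_eq_neg_add, smul_sub]

lemma QS.TT_odd (S : QS q a V) (ha : ∀ i, 2 ≤ a i) {i : Fin c} {j : Fin c → ℕ} (h : ¬ Even (j i)) :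
    S.TT i j = sgn k i j • (∑ s ∈ Finset.range (a i),
      (al q a i j • S.L i) ^ s * (be q a i j • S.R i) ^ (a i - 1 - s)) := by
  unfold QS.TT
  have h1 : dl (a i) (j i) = a i - 1 := by simp [dl, h]
  have := ha i
  rw [h1, show a i - 1 + 1 = a i by omega]
  congr 1
  refine Finset.sum_congr rfl fun s _ => ?_
  rw [smul_pow, smul_pow, smul_mul_smul_comm]
  simp [cf, h]

lemma QS.TT_sq (S : QS q a V) (ha : ∀ i, 2 ≤ a i) (i : Fin c) (j) :
    S.TT i (j + Pi.single i 1) * S.TT i j = 0 := by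
  have hc : Commute (al q a i j • S.L i) (be q a i j • S.R i) :=
    Commute.smul_left (Commute.smul_right (S.hLR i i) _) _
  have hA : (al q a i j • S.L i) ^ a i = 0 := by rw [smul_pow, S.hLa, smul_zero]
  have hB : (be q a i j • S.R i) ^ a i = 0 := by rw [smul_pow, S.hRa, smul_zero]
  by_cases h : Even (j i)
  · rw [S.TT_even h, S.TT_odd ha (by simpa [Nat.even_add_one] using h), al_add_ge i i (lt_irrefl i),
      be_add_ge i i (lt_irrefl i), smul_mul_smul_comm, hc.geom_sum₂_mul, hA, hB, sub_self, smul_zero]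
  · rw [S.TT_odd ha h, S.TT_even (by simpa [Nat.even_add_one] using h), al_add_ge i i (lt_irrefl i),
      be_add_ge i i (lt_irrefl i), smul_mul_smul_comm, hc.mul_geom_sum₂, hA, hB, sub_self, smul_zero]

lemma QS.isMC (S : QS q a V) (hqc : ∀ i j, q i j * q j i = 1) (ha : ∀ i, 2 ≤ a i) : IsMC S.T where
  sq i j v := by
    have := congrArg (fun f => f v) (S.TT_sq ha i j)
    exact this
  anti i l hil j v := by
    rcases lt_or_gt_of_ne hil with h | h
    · have := congrArg (fun f => f v) (S.TT_anti hqc i l h j)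
      exact add_eq_zero_iff_eq_neg.2 this
    · have := congrArg (fun f => f v) (S.TT_anti hqc l i h j)
      rw [add_comm]
      exact add_eq_zero_iff_eq_neg.2 this

lemma wt_add (a n p : ℕ) (ha : 2 ≤ a) : wt a (p + 2 * n) = wt a p + a * n := by
  induction n with
  | zero => simp
  | succ n ih =>
    rw [show p + 2 * (n+1) = (p + 2 * n + 1) + 1 by ring, wt_succ, wt_succ, ih, add_assoc, add_assoc]
    have : dl a (p + 2*n) + dl a (p + 2 * n + 1) = a := by
      unfold dl
      by_cases h : Even (p + 2 * n)
      · rw [if_pos h, if_neg (by simpa [Nat.even_add_one] using h)]; omega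
      · rw [if_neg h, if_pos (by simpa [Nat.even_add_one] using h)]; omega
    rw [this]; ring

lemma QS.per (S : QS q a V) (ha : ∀ i, 2 ≤ a i) {n : ℕ} (hn : ∀ i j, q i j ^ n = 1) :
    Per (2 * n) S.T := by
  intro i m j
  have hx : ∀ l, (j + Pi.single m (2 * n) : Fin c → ℕ) l = j l ∨
      (j + Pi.single m (2 * n) : Fin c → ℕ) l = j l + 2 * n := by
    intro l
    by_cases h : l = m
    · subst h; simp
    · simp [h]
  have hw : ∀ x y l, q x y ^ wt (a l) ((j + Pi.single m (2 * n) : Fin c → ℕ) l)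
      = q x y ^ wt (a l) (j l) := by
    intro x y l
    rcases hx l with h | h
    · rw [h]
    · rw [h, wt_add _ _ _ (ha l), pow_add, mul_comm (a l), pow_mul, hn, one_pow, mul_one]
  have h1 : al q a i (j + Pi.single m (2 * n)) = al q a i j := by
    unfold al; simp only [hw]
  have h2 : be q a i (j + Pi.single m (2 * n)) = be q a i j := by
    unfold be; simp only [hw]
  have h3 : sgn k i (j + Pi.single m (2 * n)) = sgn k i j := by
    unfold sgn
    refine Finset.prod_congr rfl fun l _ => ?_
    rcases hx l with h | h
    · rw [h]
    · rw [h, pow_add, pow_mul]; simp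
  have hE : Even ((j + Pi.single m (2 * n) : Fin c → ℕ) i) ↔ Even (j i) := by
    rcases hx i with h | h
    · rw [h]
    · rw [h, Nat.even_add]; simp
  have h4 : dl (a i) ((j + Pi.single m (2 * n) : Fin c → ℕ) i) = dl (a i) (j i) := by
    unfold dl; simp only [hE]
  have h5 : ∀ s, cf k ((j + Pi.single m (2 * n) : Fin c → ℕ) i) s = cf k (j i) s := by
    intro s; unfold cf; simp only [hE]
  have : S.TT i (j + Pi.single m (2 * n)) = S.TT i j := by
    unfold QS.TT
    simp only [h1, h2, h3, h4, h5]
  unfold QS.T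
  rw [this]

lemma QS.inter {W : Type} [AddCommGroup W] [Module k W] (S : QS q a V) (S' : QS q a W)
    (f : V →ₗ[k] W) (hL : ∀ i v, f (S.L i v) = S'.L i (f v)) (hR : ∀ i v, f (S.R i v) = S'.R i (f v)) :
    Inter S.T S'.T f.toAddMonoidHom := by
  intro i j v
  have hLp : ∀ s v, f ((S.L i ^ s) v) = (S'.L i ^ s) (f v) := by
    intro s
    induction s with
    | zero => intro v; simp
    | succ s ih => intro v; rw [pow_succ, pow_succ, Module.End.mul_apply, Module.End.mul_apply, ih, hL]
  have hRp : ∀ s v, f ((S.R i ^ s) v) = (S'.R i ^ s) (f v) := by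
    intro s
    induction s with
    | zero => intro v; simp
    | succ s ih => intro v; rw [pow_succ, pow_succ, Module.End.mul_apply, Module.End.mul_apply, ih, hR]
  change f (S.TT i j v) = S'.TT i j (f v)
  unfold QS.TT
  simp only [LinearMap.smul_apply, LinearMap.sum_apply, map_smul, map_sum, Module.End.mul_apply,
    hLp, hRp]

lemma QS.HZ_iff (S : QS q a V) (v : V) : HZ S.T v ↔ ∀ i, S.L i v = S.R i v := by
  refine forall_congr' fun i => ?_
  have h0 : ∀ a, wt a 0 = 0 := fun a => rfl
  rw [QS.T_apply, S.TT_even (by simp)]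
  simp [al, be, sgn, h0, sub_eq_zero]

lemma QS.HV_all (S : QS q a V) (hqc : ∀ i j, q i j * q j i = 1) (ha : ∀ i, 2 ≤ a i)
    (hroot : ∀ i j, ∃ n : ℕ, 0 < n ∧ q i j ^ n = 1)
    (h : ∃ n₀, ∀ n ≥ n₀, HV S.T n) (n : ℕ) : HV S.T n := by
  choose r hr0 hr using hroot
  obtain ⟨N, hN0, hN⟩ : ∃ N : ℕ, 0 < N ∧ ∀ i j, q i j ^ N = 1 := by
    refine ⟨∏ p : Fin c × Fin c, r p.1 p.2, Finset.prod_pos fun p _ => hr0 _ _, fun i j => ?_⟩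
    obtain ⟨m, hm⟩ := Finset.dvd_prod_of_mem (fun p : Fin c × Fin c => r p.1 p.2)
      (Finset.mem_univ (i, j))
    rw [hm, pow_mul]
    dsimp only
    rw [hr, one_pow]
  have hp := S.per ha hN
  obtain ⟨d, hd⟩ : ∃ d, 2 * N = d + 1 := ⟨2 * N - 1, by omega⟩
  rw [hd] at hp
  exact QCIaux.HV_all (S.isMC hqc ha) hp h n

end QS

end QCIaux

namespace QCIaux

/-! ### Hom complexes of modules over a quantum complete intersection -/
section HomC

variable {k : Type} [Field k] {c : ℕ} {q : Fin c → Fin c → k} {a : Fin c → ℕ}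

/-- the algebra as a separate type -/
def QQ (q : Fin c → Fin c → k) (a : Fin c → ℕ) : Type := QCI k c q a

instance qqRing : Ring (QQ q a) := inferInstanceAs (Ring (QCI k c q a))
instance qqAlg : Algebra k (QQ q a) := inferInstanceAs (Algebra k (QCI k c q a))

variable (q a) in
/-- the projection -/
def toQ : FreeAlgebra k (Fin c) →ₐ[k] QQ q a := RingQuot.mkAlgHom k (qciRel k c q a)

lemma toQ_rel {x y : FreeAlgebra k (Fin c)} (h : qciRel k c q a x y) : toQ q a x = toQ q a y :=
  RingQuot.mkAlgHom_rel k h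

lemma toQ_surj : Function.Surjective (toQ q a) :=
  RingQuot.mkAlgHom_surjective k (qciRel k c q a)

/-- the generators -/
def gx (q : Fin c → Fin c → k) (a : Fin c → ℕ) (i : Fin c) : QQ q a := toQ q a (FreeAlgebra.ι k i)

lemma gx_pow (i : Fin c) : gx q a i ^ a i = 0 := by
  unfold gx
  rw [← map_pow, toQ_rel (Or.inl ⟨i, rfl, rfl⟩), map_zero]

lemma gx_comm (i j : Fin c) : gx q a i * gx q a j = q i j • (gx q a j * gx q a i) := by
  unfold gx
  rw [← map_mul, toQ_rel (Or.inr ⟨i, j, rfl, rfl⟩), map_smul, map_mul]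

lemma gx_induct {P : QQ q a → Prop} (alg : ∀ r : k, P (algebraMap k _ r))
    (gen : ∀ i, P (gx q a i)) (mul : ∀ x y, P x → P y → P (x * y))
    (hadd : ∀ x y, P x → P y → P (x + y)) (x : QQ q a) : P x := by
  obtain ⟨y, rfl⟩ := toQ_surj x
  induction y using FreeAlgebra.induction with
  | grade0 r => rw [AlgHom.commutes]; exact alg r
  | grade1 i => exact gen i
  | mul x y hx hy => rw [map_mul]; exact mul _ _ hx hy
  | add x y hx hy => rw [map_add]; exact hadd _ _ hx hy

variable (q a)
variable (M N : Type) [AddCommGroup M] [AddCommGroup N] [Module k M] [Module k N]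
  [Module (QQ q a) M] [Module (QQ q a) N]
  [IsScalarTower k (QQ q a) M] [IsScalarTower k (QQ q a) N]

/-- left multiplication on Hom -/
def LL (b : QQ q a) : Module.End k (M →ₗ[k] N) where
  toFun f := Algebra.lsmul k k N b ∘ₗ f
  map_add' f g := by ext; simp
  map_smul' r f := by ext; simp [smul_algebra_smul_comm]

/-- right multiplication on Hom -/
def RR (b : QQ q a) : Module.End k (M →ₗ[k] N) where
  toFun f := f ∘ₗ Algebra.lsmul k k M b
  map_add' f g := by ext; simp
  map_smul' r f := by ext; simp

variable {M N}

@[simp] lemma LL_apply (b : QQ q a) (f : M →ₗ[k] N) (m : M) : LL q a M N b f m = b • f m := rfl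
@[simp] lemma RR_apply (b : QQ q a) (f : M →ₗ[k] N) (m : M) : RR q a M N b f m = f (b • m) := rfl

variable {q a}
lemma LL_mul (b d : QQ q a) : LL q a M N (b * d) = LL q a M N b * LL q a M N d := by
  ext f m; simp [mul_smul]
lemma RR_mul (b d : QQ q a) : RR q a M N (b * d) = RR q a M N d * RR q a M N b := by
  ext f m; simp [mul_smul]
lemma LL_one : LL q a M N 1 = 1 := by ext f m; simp
lemma RR_one : RR q a M N 1 = 1 := by ext f m; simp
lemma LL_pow (b : QQ q a) (n : ℕ) : LL q a M N (b ^ n) = LL q a M N b ^ n := by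
  induction n with
  | zero => rw [pow_zero, pow_zero, LL_one]
  | succ n ih => rw [pow_succ, pow_succ, LL_mul, ih]
lemma RR_pow (b : QQ q a) (n : ℕ) : RR q a M N (b ^ n) = RR q a M N b ^ n := by
  induction n with
  | zero => rw [pow_zero, pow_zero, RR_one]
  | succ n ih => rw [pow_succ', pow_succ, RR_mul, ih]
lemma LL_smul (r : k) (b : QQ q a) : LL q a M N (r • b) = r • LL q a M N b := by
  ext f m; simp
lemma RR_smul (r : k) (b : QQ q a) : RR q a M N (r • b) = r • RR q a M N b := by
  ext f m; simp

variable (q a M N)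

/-- the q-structure on Hom_k(M,N) -/
def homQS : QS q a (M →ₗ[k] N) where
  L i := LL q a M N (gx q a i)
  R i := RR q a M N (gx q a i)
  hL i j := by rw [← LL_mul, gx_comm, LL_smul, LL_mul]
  hR i j := by rw [← RR_mul, gx_comm, RR_smul, RR_mul]
  hLR i j := by ext f m; simp
  hLa i := by rw [← LL_pow, gx_pow]; ext f m; simp
  hRa i := by rw [← RR_pow, gx_pow]; ext f m; simp

/-- the differentials of the Hom complex -/
abbrev CT := (homQS q a M N).T

/-- vanishing in degree n+1 -/
abbrev EV (n : ℕ) : Prop := HV (CT q a M N) n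

variable {q a M N}

@[simp] lemma homQS_L (i : Fin c) (f : M →ₗ[k] N) (m : M) :
    (homQS q a M N).L i f m = gx q a i • f m := rfl
@[simp] lemma homQS_R (i : Fin c) (f : M →ₗ[k] N) (m : M) :
    (homQS q a M N).R i f m = f (gx q a i • m) := rfl

lemma HZ_lin {f : M →ₗ[k] N} (h : HZ (CT q a M N) f) (b : QQ q a) (m : M) :
    f (b • m) = b • f m := by
  rw [QS.HZ_iff] at h
  have h' : ∀ i m, f (gx q a i • m) = gx q a i • f m := fun i m => (LinearMap.congr_fun (h i) m).symm
  induction b using gx_induct generalizing m with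
  | alg r => rw [algebraMap_smul, algebraMap_smul, map_smul]
  | gen i => exact h' i m
  | mul x y hx hy => rw [mul_smul, hx, hy, mul_smul]
  | hadd x y hx hy => rw [add_smul, map_add, hx, hy, add_smul]

lemma HZ_of_lin (f : M →ₗ[QQ q a] N) : HZ (CT q a M N) (f.restrictScalars k) := by
  rw [QS.HZ_iff]
  intro i
  ext m
  simp

/-- linear map from a degree zero cocycle -/
def toLin {f : M →ₗ[k] N} (h : HZ (CT q a M N) f) : M →ₗ[QQ q a] N where
  toFun := f
  map_add' := map_add f
  map_smul' b m := HZ_lin h b m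

variable {M' N' : Type} [AddCommGroup M'] [AddCommGroup N'] [Module k M'] [Module k N']
  [Module (QQ q a) M'] [Module (QQ q a) N']
  [IsScalarTower k (QQ q a) M'] [IsScalarTower k (QQ q a) N']

variable (N) in
/-- precomposition -/
def pre (p : M' →ₗ[QQ q a] M) : (M →ₗ[k] N) →ₗ[k] (M' →ₗ[k] N) :=
  LinearMap.lcomp k N (p.restrictScalars k)

variable (M) in
/-- postcomposition -/
def post (p : N →ₗ[QQ q a] N') : (M →ₗ[k] N) →ₗ[k] (M →ₗ[k] N') where
  toFun f := p.restrictScalars k ∘ₗ f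
  map_add' f g := by ext; simp
  map_smul' r f := by ext; simp

@[simp] lemma pre_apply (p : M' →ₗ[QQ q a] M) (f : M →ₗ[k] N) (m : M') :
    pre N p f m = f (p m) := rfl
@[simp] lemma post_apply (p : N →ₗ[QQ q a] N') (f : M →ₗ[k] N) (m : M) :
    post M p f m = p (f m) := rfl

lemma inter_pre (p : M' →ₗ[QQ q a] M) :
    Inter (CT q a M N) (CT q a M' N) (pre N p).toAddMonoidHom :=
  QS.inter _ _ _ (fun i v => by ext m; simp) (fun i v => by ext m; simp)

lemma inter_post (p : N →ₗ[QQ q a] N') :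
    Inter (CT q a M N) (CT q a M N') (post M p).toAddMonoidHom :=
  QS.inter _ _ _ (fun i v => by ext m; simp) (fun i v => by ext m; simp)

variable {Z P X : Type} [AddCommGroup Z] [AddCommGroup P] [AddCommGroup X]
  [Module k Z] [Module k P] [Module k X]
  [Module (QQ q a) Z] [Module (QQ q a) P] [Module (QQ q a) X]
  [IsScalarTower k (QQ q a) Z] [IsScalarTower k (QQ q a) P]
  [IsScalarTower k (QQ q a) X]

lemma ses_pre (N : Type) [AddCommGroup N] [Module k N]
    [Module (QQ q a) N] [IsScalarTower k (QQ q a) N]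
    (i : Z →ₗ[QQ q a] P) (p : P →ₗ[QQ q a] X) (hi : Function.Injective i)
    (hp : Function.Surjective p) (he : ∀ y, p y = 0 ↔ ∃ z, i z = y) :
    SES (CT q a X N) (CT q a P N) (CT q a Z N) (pre N p).toAddMonoidHom (pre N i).toAddMonoidHom where
  h₁ := inter_pre p
  h₂ := inter_pre i
  hi := by
    intro f g h
    ext m
    obtain ⟨y, rfl⟩ := hp m
    exact LinearMap.congr_fun h y
  hs := by
    obtain ⟨r, hr⟩ := LinearMap.exists_leftInverse_of_injective (i.restrictScalars k)
      (LinearMap.ker_eq_bot.2 hi)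
    intro f
    refine ⟨f ∘ₗ r, ?_⟩
    ext z
    exact congrArg f (LinearMap.congr_fun hr z)
  he := by
    obtain ⟨s, hs⟩ := LinearMap.exists_rightInverse_of_surjective (p.restrictScalars k)
      (LinearMap.range_eq_top.2 hp)
    have hs' : ∀ m, p (s m) = m := fun m => LinearMap.congr_fun hs m
    intro f hf
    refine ⟨f ∘ₗ s, ?_⟩
    ext y
    change f (s (p y)) = f y
    obtain ⟨z, hz⟩ := (he (s (p y) - y)).1 (by rw [map_sub, hs', sub_self])
    have h2 : f (i z) = 0 := LinearMap.congr_fun hf z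
    rw [hz, map_sub, sub_eq_zero] at h2
    exact h2
  hz := by
    intro f
    ext z
    change f (p (i z)) = 0
    rw [(he _).2 ⟨z, rfl⟩, map_zero]

lemma ses_post (M : Type) [AddCommGroup M] [Module k M]
    [Module (QQ q a) M] [IsScalarTower k (QQ q a) M]
    (i : Z →ₗ[QQ q a] P) (p : P →ₗ[QQ q a] X) (hi : Function.Injective i)
    (hp : Function.Surjective p) (he : ∀ y, p y = 0 ↔ ∃ z, i z = y) :
    SES (CT q a M Z) (CT q a M P) (CT q a M X) (post M i).toAddMonoidHom (post M p).toAddMonoidHom where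
  h₁ := inter_post i
  h₂ := inter_post p
  hi := by
    intro f g h
    ext m
    exact hi (LinearMap.congr_fun h m)
  hs := by
    obtain ⟨s, hs⟩ := LinearMap.exists_rightInverse_of_surjective (p.restrictScalars k)
      (LinearMap.range_eq_top.2 hp)
    intro f
    refine ⟨s ∘ₗ f, ?_⟩
    ext y
    exact LinearMap.congr_fun hs (f y)
  he := by
    obtain ⟨r, hr⟩ := LinearMap.exists_leftInverse_of_injective (i.restrictScalars k)
      (LinearMap.ker_eq_bot.2 hi)
    have hr' : ∀ z, r (i z) = z := fun z => LinearMap.congr_fun hr z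
    intro f hf
    refine ⟨r ∘ₗ f, ?_⟩
    ext m
    change i (r (f m)) = f m
    obtain ⟨z, hz⟩ := (he (f m)).1 (LinearMap.congr_fun hf m)
    rw [← hz, hr']
  hz := by
    intro f
    ext z
    exact (he _).2 ⟨f z, rfl⟩


/-- every linear map from a submodule extends -/
def ExtLin (N : Type) [AddCommGroup N] [Module (QQ q a) N] (i : Z →ₗ[QQ q a] P) : Prop :=
  ∀ f : Z →ₗ[QQ q a] N, ∃ g : P →ₗ[QQ q a] N, ∀ z, g (i z) = f z

lemma lift_iff_ext (i : Z →ₗ[QQ q a] P) :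
    Lift (CT q a P N) (CT q a Z N) (pre N i).toAddMonoidHom 0 ↔ ExtLin N i := by
  rw [Lift_zero]
  constructor
  · intro h f
    obtain ⟨w, hw, hwf⟩ := h _ (HZ_of_lin f)
    exact ⟨toLin hw, fun z => LinearMap.congr_fun hwf z⟩
  · intro h v hv
    obtain ⟨g, hg⟩ := h (toLin hv)
    exact ⟨g.restrictScalars k, HZ_of_lin g, by ext z; exact hg z⟩

lemma lift_iff_lift (p : P →ₗ[QQ q a] X) :
    Lift (CT q a M P) (CT q a M X) (post M p).toAddMonoidHom 0 ↔
      ∀ f : M →ₗ[QQ q a] X, ∃ g : M →ₗ[QQ q a] P, ∀ z, p (g z) = f z := by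
  rw [Lift_zero]
  constructor
  · intro h f
    obtain ⟨w, hw, hwf⟩ := h _ (HZ_of_lin f)
    exact ⟨toLin hw, fun z => LinearMap.congr_fun hwf z⟩
  · intro h v hv
    obtain ⟨g, hg⟩ := h (toLin hv)
    exact ⟨g.restrictScalars k, HZ_of_lin g, by ext z; exact hg z⟩

lemma shift_zero (hqc : ∀ i j, q i j * q j i = 1) (ha : ∀ i, 2 ≤ a i)
    (i : Z →ₗ[QQ q a] P) (p : P →ₗ[QQ q a] X) (hi : Function.Injective i)
    (hp : Function.Surjective p) (he : ∀ y, p y = 0 ↔ ∃ z, i z = y) (hP : EV q a P N 0) :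
    EV q a X N 0 ↔ ExtLin N i := by
  have S := ses_pre N i p hi hp he
  rw [← lift_iff_ext]
  exact ⟨fun h => S.les_a (QS.isMC _ hqc ha) h, fun h => S.les_b h hP⟩

lemma shift_succ (hqc : ∀ i j, q i j * q j i = 1) (ha : ∀ i, 2 ≤ a i)
    (i : Z →ₗ[QQ q a] P) (p : P →ₗ[QQ q a] X) (hi : Function.Injective i)
    (hp : Function.Surjective p) (he : ∀ y, p y = 0 ↔ ∃ z, i z = y) (hP : ∀ n, EV q a P N n) (n : ℕ) :
    EV q a X N (n+1) ↔ EV q a Z N n := by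
  have S := ses_pre N i p hi hp he
  exact ⟨fun h => S.les_d (S.les_a (QS.isMC _ hqc ha) h) (hP n),
    fun h => S.les_b (S.les_c (QS.isMC _ hqc ha) h) (hP (n+1))⟩

/-- covariant dimension shift -/
lemma shift_cov (hqc : ∀ i j, q i j * q j i = 1) (ha : ∀ i, 2 ≤ a i)
    (i : Z →ₗ[QQ q a] P) (p : P →ₗ[QQ q a] X) (hi : Function.Injective i)
    (hp : Function.Surjective p) (he : ∀ y, p y = 0 ↔ ∃ z, i z = y) (hP : ∀ n, EV q a M P n) (n : ℕ) :
    EV q a M Z (n+1) ↔ EV q a M X n := by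
  have S := ses_post M i p hi hp he
  exact ⟨fun h => S.les_d (S.les_a (QS.isMC _ hqc ha) h) (hP n),
    fun h => S.les_b (S.les_c (QS.isMC _ hqc ha) h) (hP (n+1))⟩

lemma EV_zero_of_subsingleton [Subsingleton N] (n : ℕ) : EV q a M N n := by
  intro F hF _
  refine ⟨0, Hm_zero, fun j => ?_⟩
  ext m
  exact Subsingleton.elim _ _

end HomC

end QCIaux

namespace QCIaux

/-! ### Acyclicity of the one sided complex -/
section OneSided

variable {k : Type} [Field k] {c : ℕ} {q : Fin c → Fin c → k} {a : Fin c → ℕ}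
  {V : Type} [AddCommGroup V] [Module k V]

lemma QS.TT_L0 (S : QS q a V) (hqc : ∀ i j, q i j * q j i = 1) (hL : ∀ i, S.L i = 0)
    (i : Fin c) (j : Fin c → ℕ) :
    ∃ u : k, u ≠ 0 ∧ S.TT i j = u • S.R i ^ (dl (a i) (j i)) := by
  refine ⟨sgn k i j * (cf k (j i) 0 * be q a i j ^ (dl (a i) (j i))), ?_, ?_⟩
  · refine mul_ne_zero ?_ (mul_ne_zero ?_ (pow_ne_zero _ ?_))
    · unfold sgn
      refine Finset.prod_ne_zero_iff.2 fun l _ => ?_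
      split_ifs <;> simp
    · unfold cf; split_ifs <;> simp
    · unfold be
      refine Finset.prod_ne_zero_iff.2 fun l _ => ?_
      split_ifs
      · exact pow_ne_zero _ (left_ne_zero_of_mul_eq_one (hqc i l))
      · exact one_ne_zero
  · unfold QS.TT
    rw [Finset.sum_eq_single 0]
    · simp [smul_smul]
    · intro s _ hs
      rw [hL, zero_pow hs]; simp
    · simp

lemma QS.R_pow_zero (S : QS q a V) (i l : Fin c) {v : V} (h : S.R l v = 0) (s : ℕ) :
    S.R l ((S.R i ^ s) v) = 0 := by
  induction s with
  | zero => simpa using h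
  | succ s ih =>
    rw [pow_succ', Module.End.mul_apply, ← Module.End.mul_apply, S.hR, LinearMap.smul_apply,
      Module.End.mul_apply, ih]
    simp

lemma dl_pos (ha : 2 ≤ a i) (t : ℕ) : 1 ≤ dl (a i) t := by
  unfold dl; split_ifs <;> omega

lemma dl_add (i : Fin c) (ha : 2 ≤ a i) (t : ℕ) : dl (a i) t + dl (a i) (t+1) = a i := by
  unfold dl
  by_cases h : Even t
  · rw [if_pos h, if_neg (by simpa [Nat.even_add_one] using h)]; omega
  · rw [if_neg h, if_pos (by simpa [Nat.even_add_one] using h)]; omega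

/-- elimination of the top layer in direction m -/
lemma QS.elim_top (S : QS q a V) (hqc : ∀ i j, q i j * q j i = 1) (ha : ∀ i, 2 ≤ a i)
    (hL : ∀ i, S.L i = 0) (m : Fin c)
    (Ex : ∀ s, 1 ≤ s → s < a m → ∀ v, (∀ l, m < l → S.R l v = 0) →
      (S.R m ^ (a m - s)) v = 0 → ∃ w, (∀ l, m < l → S.R l w = 0) ∧ (S.R m ^ s) w = v)
    (n t : ℕ) (F : (Fin c → ℕ) → V) (hF : Hm (n+1) F) (hc : ∀ j, D S.T F j = 0)
    (hv : ∀ j l, m < l → S.R l (F j) = 0)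
    (hs : ∀ j l, m < l → j l ≠ 0 → F j = 0) (ht : ∀ j, t + 1 < j m → F j = 0) :
    ∃ G, Hm n G ∧ (∀ j l, m < l → S.R l ((F - D S.T G) j) = 0) ∧
      (∀ j l, m < l → j l ≠ 0 → (F - D S.T G) j = 0) ∧
      (∀ j, t < j m → (F - D S.T G) j = 0) := by
  choose u hu0 hu using S.TT_L0 hqc hL
  -- the top layer is in the kernel
  have hk : ∀ j : Fin c → ℕ, j m = t + 1 → (S.R m ^ dl (a m) (t+1)) (F j) = 0 := by
    intro j hj
    by_cases hj0 : ∀ l, m < l → j l = 0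
    · have h1 := hc (j + Pi.single m 1)
      unfold D at h1
      rw [Finset.sum_eq_single m] at h1
      · rw [if_pos (by simp)] at h1
        have e : j + Pi.single m 1 - Pi.single m 1 = j := by simp
        rw [e, QS.T_apply, hu, hj] at h1
        exact (smul_eq_zero.1 h1).resolve_left (hu0 _ _)
      · intro i _ him
        split_ifs with h
        · have : F (j + Pi.single m 1 - Pi.single i 1) = 0 := by
            apply ht
            simp [Pi.single_apply, him.symm, hj]
          rw [this, map_zero]
        · rfl
      · simp
    · push Not at hj0
      obtain ⟨l, hl, hl0⟩ := hj0
      rw [hs j l hl hl0, map_zero]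
  have hw : ∀ j : Fin c → ℕ, j m = t + 1 → ∃ w, (∀ l, m < l → S.R l w = 0) ∧
      (S.R m ^ dl (a m) t) w = F j := by
    intro j hj
    have h1 := dl_add m (ha m) t
    have h2 : 1 ≤ dl (a m) (t+1) := dl_pos (ha m) _
    refine Ex _ (dl_pos (ha m) t) (by omega) _ (hv j) ?_
    rw [show a m - dl (a m) t = dl (a m) (t+1) by omega]
    exact hk j hj
  choose w hw1 hw2 using hw
  let G : (Fin c → ℕ) → V := fun j =>
    if h : j m = t ∧ (∀ l, m < l → j l = 0) ∧ ∑ i, j i = n then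
      (u m j)⁻¹ • w (j + Pi.single m 1) (by simp [h.1]) else 0
  have hG1 : ∀ j, ¬ (j m = t ∧ (∀ l, m < l → j l = 0) ∧ ∑ i, j i = n) → G j = 0 :=
    fun j h => dif_neg h
  have hGR : ∀ j l, m < l → S.R l (G j) = 0 := by
    intro j l hl
    dsimp only [G]
    split_ifs with h
    · rw [map_smul, hw1 _ _ l hl, smul_zero]
    · simp
  have hTG : ∀ i j, m < i → S.T i j (G j) = 0 := by
    intro i j hi
    rw [QS.T_apply, hu]
    have : dl (a i) (j i) ≠ 0 := by have := dl_pos (ha i) (j i); omega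
    obtain ⟨e, he⟩ := Nat.exists_eq_succ_of_ne_zero this
    rw [he, pow_succ, LinearMap.smul_apply, Module.End.mul_apply, hGR _ _ hi, map_zero, smul_zero]
  have hGm : Hm n G := fun j hj => hG1 j (fun h => hj h.2.2)
  refine ⟨G, hGm, ?_, ?_, ?_⟩
  · intro j l hl
    rw [Pi.sub_apply, map_sub, hv j l hl, zero_sub, neg_eq_zero]
    unfold D
    rw [map_sum]
    refine Finset.sum_eq_zero fun i _ => ?_
    split_ifs with h
    · rw [QS.T_apply, hu, LinearMap.smul_apply, map_smul, S.R_pow_zero _ _ (hGR _ _ hl), smul_zero]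
    · simp
  · intro j l hl hj
    rw [Pi.sub_apply, hs j l hl hj, zero_sub, neg_eq_zero]
    unfold D
    refine Finset.sum_eq_zero fun i _ => ?_
    split_ifs with h
    · by_cases hi : m < i
      · exact hTG _ _ hi
      · rw [hG1, map_zero]
        intro h'
        have := h'.2.1 l hl
        have hil : l ≠ i := fun e => hi (e ▸ hl)
        simp [Pi.single_apply, hil] at this
        exact hj this
    · rfl
  · intro j hj
    by_cases hjt : j m = t + 1
    · by_cases hj0 : (∀ l, m < l → j l = 0) ∧ ∑ i, j i = n + 1
      · have hp : 0 < j m := by omega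
        rw [Pi.sub_apply, sub_eq_zero]
        unfold D
        rw [Finset.sum_eq_single m]
        · rw [if_pos hp]
          have h1 := sub_add_single hp
          have h2 := sum_sub_single hp
          have hcond : (j - Pi.single m 1 : Fin c → ℕ) m = t ∧
              (∀ l, m < l → (j - Pi.single m 1 : Fin c → ℕ) l = 0) ∧
              ∑ i, (j - Pi.single m 1 : Fin c → ℕ) i = n := by
            refine ⟨by simp [hjt], fun l hl => ?_, by omega⟩
            have := hj0.1 l hl
            simp [this]
          rw [QS.T_apply, hu, hcond.1]
          dsimp only [G]
          rw [dif_pos hcond, LinearMap.smul_apply, map_smul, smul_smul,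
            mul_inv_cancel₀ (hu0 _ _), one_smul, hw2]
          rw [h1]
        · intro i _ him
          split_ifs with h
          · rw [hG1, map_zero]
            intro h'
            have := h'.1
            simp [Pi.single_apply, him.symm] at this
            omega
          · rfl
        · simp
      · have hF0 : F j = 0 := by
          by_contra hne
          apply hj0
          refine ⟨fun l hl => ?_, ?_⟩
          · by_contra h; exact hne (hs j l hl h)
          · by_contra h; exact hne (hF j h)
        rw [Pi.sub_apply, hF0, zero_sub, neg_eq_zero]
        by_cases hn : ∑ i, j i = n + 1
        · have : ∃ l, m < l ∧ j l ≠ 0 := by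
            by_contra h; push Not at h; exact hj0 ⟨h, hn⟩
          obtain ⟨l, hl, hl0⟩ := this
          unfold D
          refine Finset.sum_eq_zero fun i _ => ?_
          split_ifs with h
          · by_cases hi : m < i
            · exact hTG _ _ hi
            · rw [hG1, map_zero]
              intro h'
              have := h'.2.1 l hl
              have hil : l ≠ i := fun e => hi (e ▸ hl)
              simp [Pi.single_apply, hil] at this
              exact hl0 this
          · rfl
        · exact Hm_D hGm j hn
    · rw [Pi.sub_apply, ht j (by omega), zero_sub, neg_eq_zero]
      unfold D
      refine Finset.sum_eq_zero fun i _ => ?_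
      split_ifs with h
      · rw [hG1, map_zero]
        intro h'
        have := h'.1
        by_cases him : m = i
        · subst him; simp at this; omega
        · simp [Pi.single_apply, him] at this
          omega
      · rfl

lemma QS.acyclic (S : QS q a V) (hqc : ∀ i j, q i j * q j i = 1) (ha : ∀ i, 2 ≤ a i)
    (hL : ∀ i, S.L i = 0)
    (Ex : ∀ m s, 1 ≤ s → s < a m → ∀ v, (∀ l, m < l → S.R l v = 0) →
      (S.R m ^ (a m - s)) v = 0 → ∃ w, (∀ l, m < l → S.R l w = 0) ∧ (S.R m ^ s) w = v)
    (n : ℕ) : HV S.T n := by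
  have main : ∀ m ≤ c, ∀ F : (Fin c → ℕ) → V, Hm (n+1) F → (∀ j, D S.T F j = 0) →
      (∀ j (l : Fin c), m ≤ l.1 → S.R l (F j) = 0) →
      (∀ j (l : Fin c), m ≤ l.1 → j l ≠ 0 → F j = 0) → ∃ G, Hm n G ∧ ∀ j, D S.T G j = F j := by
    intro m
    induction m with
    | zero =>
      intro _ F hF _ _ hs
      refine ⟨0, Hm_zero, fun j => ?_⟩
      rw [D_zero]
      by_cases hj : ∃ l, j l ≠ 0
      · obtain ⟨l, hl⟩ := hj
        exact (hs j l (Nat.zero_le _) hl).symm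
      · push Not at hj
        exact (hF j (by simp [hj])).symm
    | succ m ih =>
      intro hm F hF hc hv hs
      let m' : Fin c := ⟨m, hm⟩
      have hlt : ∀ l : Fin c, m' < l ↔ m + 1 ≤ l.1 := fun l => Iff.rfl
      have main2 : ∀ t, ∀ F : (Fin c → ℕ) → V, Hm (n+1) F → (∀ j, D S.T F j = 0) →
          (∀ j (l : Fin c), m' < l → S.R l (F j) = 0) →
          (∀ j (l : Fin c), m' < l → j l ≠ 0 → F j = 0) → (∀ j, t < j m' → F j = 0) →
          ∃ G, Hm n G ∧ ∀ j, D S.T G j = F j := by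
        intro t
        induction t with
        | zero =>
          intro F hF hc hv hs ht
          have hs' : ∀ j (l : Fin c), m ≤ l.1 → j l ≠ 0 → F j = 0 := by
            intro j l hl hj
            by_cases h : m' < l
            · exact hs j l h hj
            · have : l = m' := Fin.ext (by have := (hlt l).not.1 h; simp only [m']; omega)
              subst this
              exact ht j (by omega)
          refine ih (by omega) F hF hc ?_ hs'
          intro j l hl
          by_cases h : m' < l
          · exact hv j l h
          · have : l = m' := Fin.ext (by have := (hlt l).not.1 h; simp only [m']; omega)
            subst this
            by_cases hj0 : j m' = 0
            · have h1 := hc (j + Pi.single m' 1)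
              obtain ⟨u, hu0, hu⟩ := S.TT_L0 hqc hL m' j
              unfold D at h1
              rw [Finset.sum_eq_single m'] at h1
              · rw [if_pos (by simp)] at h1
                have e : j + Pi.single m' 1 - Pi.single m' 1 = j := by simp
                rw [e, QS.T_apply, hu, hj0] at h1
                have := (smul_eq_zero.1 h1).resolve_left hu0
                simpa [dl] using this
              · intro i _ him
                split_ifs with h
                · have : F (j + Pi.single m' 1 - Pi.single i 1) = 0 := by
                    apply ht
                    simp [Pi.single_apply, him.symm, hj0]
                  rw [this, map_zero]
                · rfl
              · simp
            · rw [ht j (by omega), map_zero]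
        | succ t iht =>
          intro F hF hc hv hs ht
          obtain ⟨G, hG, h1, h2, h3⟩ := S.elim_top hqc ha hL m' (Ex m') n t F hF hc hv hs ht
          obtain ⟨K, hK, hKD⟩ := iht (F - D S.T G) (Hm_sub hF (Hm_D hG))
            (fun j => by rw [D_sub, hc, D_D (S.isMC hqc ha), sub_zero]) h1 h2 h3
          refine ⟨K + G, Hm_add hK hG, fun j => ?_⟩
          rw [D_add, hKD]
          simp
      refine main2 (n+1) F hF hc hv hs ?_
      intro j hj
      apply hF
      have := Finset.single_le_sum (f := j) (fun i _ => Nat.zero_le _) (Finset.mem_univ m')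
      omega
  intro F hF hc
  refine main c le_rfl F hF hc ?_ ?_
  · intro j l hl; exact absurd l.2 (by omega)
  · intro j l hl; exact absurd l.2 (by omega)

end OneSided

end QCIaux

namespace QCIaux

/-! ### A model module -/
section Model

variable {k : Type} [Field k] {c : ℕ} (q : Fin c → Fin c → k) (a : Fin c → ℕ)

/-- the commutation factor -/
def kap (i : Fin c) (u : Fin c → ℕ) : k := ∏ l, if l < i then q i l ^ u l else 1

/-- operator on the model -/
def XX (i : Fin c) : Module.End k ((Fin c → ℕ) →₀ k) :=
  Finsupp.lsum k fun u => LinearMap.toSpanSingleton k _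
    (if a i ∣ u i + 1 then 0 else Finsupp.single (u + Pi.single i 1) (kap q i u))

variable {q a}

lemma XX_single (i : Fin c) (u : Fin c → ℕ) :
    XX q a i (Finsupp.single u 1) =
      if a i ∣ u i + 1 then 0 else kap q i u • Finsupp.single (u + Pi.single i 1) 1 := by
  simp [XX]

lemma kap_ne (hqc : ∀ i j, q i j * q j i = 1) (i : Fin c) (u : Fin c → ℕ) : kap q i u ≠ 0 := by
  unfold kap
  refine Finset.prod_ne_zero_iff.2 fun l _ => ?_
  split_ifs
  · exact pow_ne_zero _ (left_ne_zero_of_mul_eq_one (hqc i l))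
  · exact one_ne_zero

lemma kap_congr (i : Fin c) {u v : Fin c → ℕ} (h : ∀ l, l < i → u l = v l) :
    kap q i u = kap q i v := by
  unfold kap
  refine Finset.prod_congr rfl fun l _ => ?_
  split_ifs with hl
  · rw [h l hl]
  · rfl

lemma kap_add_ge (i m : Fin c) (h : ¬ m < i) (u : Fin c → ℕ) (s : ℕ) :
    kap q i (u + Pi.single m s) = kap q i u := by
  apply kap_congr
  intro l hl
  have : l ≠ m := fun e => h (e ▸ hl)
  simp [this]

lemma kap_add_lt (i m : Fin c) (h : m < i) (u : Fin c → ℕ) :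
    kap q i (u + Pi.single m 1) = q i m * kap q i u := by
  rw [mul_comm]
  unfold kap
  refine prod_upd m _ ?_ ?_
  · simp [h, pow_succ]
  · intro l hl; simp [hl]

lemma XX_comm_lt (hqc : ∀ i j, q i j * q j i = 1) (i j : Fin c) (hij : i < j) :
    XX q a i * XX q a j = q i j • (XX q a j * XX q a i) := by
  apply Finsupp.lhom_ext'
  intro u
  ext1
  simp only [LinearMap.comp_apply, Finsupp.lsingle_apply, LinearMap.smul_apply, Module.End.mul_apply,
    XX_single]
  have h1 : (u + Pi.single j 1 : Fin c → ℕ) i = u i := by simp [hij.ne]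
  have h2 : (u + Pi.single i 1 : Fin c → ℕ) j = u j := by simp [hij.ne']
  by_cases hi : a i ∣ u i + 1
  · by_cases hj : a j ∣ u j + 1
    · simp [hi, hj]
    · rw [if_pos hi, if_neg hj, map_smul, XX_single, h1, if_pos hi]; simp
  · by_cases hj : a j ∣ u j + 1
    · rw [if_neg hi, if_pos hj, map_smul, XX_single, h2, if_pos hj]; simp
    · rw [if_neg hi, if_neg hj, map_smul, map_smul, XX_single, XX_single, h1, h2, if_neg hi, if_neg hj,
        kap_add_ge _ _ (by exact hij.asymm), kap_add_lt _ _ hij, add_right_comm u]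
      simp only [smul_smul]
      congr 1
      calc kap q j u * kap q i u = (q i j * q j i) * (kap q i u * kap q j u) := by rw [hqc]; ring
        _ = _ := by ring

lemma XX_comm (hqd : ∀ i, q i i = 1) (hqc : ∀ i j, q i j * q j i = 1) (i j : Fin c) :
    XX q a i * XX q a j = q i j • (XX q a j * XX q a i) := by
  rcases lt_trichotomy i j with h | h | h
  · exact XX_comm_lt hqc i j h
  · subst h; rw [hqd, one_smul]
  · rw [XX_comm_lt hqc j i h, smul_smul, hqc, one_smul]

lemma XX_pow (i : Fin c) (u : Fin c → ℕ) (s : ℕ) (h : u i % a i + s < a i) :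
    (XX q a i ^ s) (Finsupp.single u 1) = kap q i u ^ s • Finsupp.single (u + Pi.single i s) 1 := by
  induction s with
  | zero => simp
  | succ s ih =>
    rw [pow_succ', Module.End.mul_apply, ih (by omega), map_smul, XX_single, if_neg,
      kap_add_ge _ _ (lt_irrefl _), smul_smul, ← pow_succ, add_assoc, ← Pi.single_add]
    intro hd
    simp only [Pi.add_apply, Pi.single_eq_same] at hd
    have h1 : (u i % a i + s + 1) % a i = 0 := by
      have := Nat.mod_eq_zero_of_dvd hd
      rw [← this, add_assoc, add_assoc (u i), Nat.mod_add_mod]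
    rw [Nat.mod_eq_of_lt (by omega)] at h1
    omega

lemma XX_pow_zero (i : Fin c) (u : Fin c → ℕ) (s : ℕ) (ha : 2 ≤ a i) (h : a i ≤ u i % a i + s) :
    (XX q a i ^ s) (Finsupp.single u 1) = 0 := by
  have hlt := Nat.mod_lt (u i) (show a i > 0 by omega)
  obtain ⟨t, r, hs, ht⟩ : ∃ t r, s = r + (1 + t) ∧ u i % a i + t + 1 = a i :=
    ⟨a i - 1 - u i % a i, s - (a i - u i % a i), by omega, by omega⟩
  rw [hs, pow_add, pow_add, Module.End.mul_apply, Module.End.mul_apply, XX_pow _ _ _ (by omega),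
    pow_one, map_smul, XX_single, if_pos, smul_zero, map_zero]
  simp only [Pi.add_apply, Pi.single_eq_same]
  refine Nat.dvd_of_mod_eq_zero ?_
  rw [add_assoc, ← Nat.mod_add_mod, ← add_assoc, ht, Nat.mod_self]

lemma XX_pow_a (ha : ∀ i, 2 ≤ a i) (i : Fin c) : XX q a i ^ a i = 0 := by
  apply Finsupp.lhom_ext'
  intro u
  ext1
  simp only [LinearMap.comp_apply, Finsupp.lsingle_apply]
  rw [XX_pow_zero _ _ _ (ha i) (by omega)]
  simp

/-- dual operator used for exactness -/
def DD (m : Fin c) (s : ℕ) (q : Fin c → Fin c → k) (a : Fin c → ℕ) : Module.End k ((Fin c → ℕ) →₀ k) :=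
  Finsupp.lsum k fun u => LinearMap.toSpanSingleton k _
    (if s ≤ u m % a m then Finsupp.single (u - Pi.single m s) ((kap q m u ^ s)⁻¹) else 0)

lemma DD_single (m : Fin c) (s : ℕ) (u : Fin c → ℕ) :
    DD m s q a (Finsupp.single u 1) =
      if s ≤ u m % a m then (kap q m u ^ s)⁻¹ • Finsupp.single (u - Pi.single m s) 1 else 0 := by
  simp [DD]

variable {N : Type} [AddCommGroup N] [Module k N]

lemma lin_ext {f g : ((Fin c → ℕ) →₀ k) →ₗ[k] N}
    (h : ∀ u, f (Finsupp.single u 1) = g (Finsupp.single u 1)) : f = g := by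
  apply Finsupp.lhom_ext'
  intro u
  ext1
  exact h u

lemma model_exact (hqc : ∀ i j, q i j * q j i = 1) (ha : ∀ i, 2 ≤ a i) (m : Fin c) (s : ℕ)
    (h1 : 1 ≤ s) (h2 : s < a m) (f : ((Fin c → ℕ) →₀ k) →ₗ[k] N)
    (hl : ∀ l, m < l → ∀ v, f (XX q a l v) = 0) (hm : ∀ v, f ((XX q a m ^ (a m - s)) v) = 0) :
    ∃ g : ((Fin c → ℕ) →₀ k) →ₗ[k] N, (∀ l, m < l → ∀ v, g (XX q a l v) = 0) ∧
      ∀ v, g ((XX q a m ^ s) v) = f v := by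
  have ham := ha m
  refine ⟨f ∘ₗ DD m s q a, ?_, ?_⟩
  · intro l hml
    suffices h : (f ∘ₗ DD m s q a) ∘ₗ XX q a l = 0 from fun v => LinearMap.congr_fun h v
    apply lin_ext
    intro u
    simp only [LinearMap.comp_apply, XX_single, LinearMap.zero_apply]
    split_ifs with hd
    · simp
    · rw [map_smul, DD_single]
      have e1 : (u + Pi.single l 1 : Fin c → ℕ) m = u m := by simp [hml.ne]
      rw [e1]
      split_ifs with hs
      · have hsu : s ≤ u m := hs.trans (Nat.mod_le _ _)
        have e2 : u + Pi.single l 1 - Pi.single m s = (u - Pi.single m s) + Pi.single l 1 := by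
          funext x
          by_cases hx : x = m
          · subst hx; simp [hml.ne]
          · simp [hx]
        have e3 : (u - Pi.single m s : Fin c → ℕ) l = u l := by simp [hml.ne']
        have := hl l hml (Finsupp.single (u - Pi.single m s) 1)
        rw [XX_single, e3, if_neg hd, map_smul] at this
        have h0 := (smul_eq_zero.1 this).resolve_left (kap_ne hqc _ _)
        rw [e2, map_smul, map_smul, h0, smul_zero, smul_zero]
      · simp
  · suffices h : (f ∘ₗ DD m s q a) ∘ₗ (XX q a m ^ s) = f from fun v => LinearMap.congr_fun h v
    apply lin_ext
    intro u
    simp only [LinearMap.comp_apply]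
    have hlt := Nat.mod_lt (u m) (show a m > 0 by omega)
    by_cases hs : u m % a m + s < a m
    · rw [XX_pow _ _ _ hs, map_smul, DD_single, if_pos, kap_add_ge _ _ (lt_irrefl _), smul_smul,
        mul_inv_cancel₀ (pow_ne_zero _ (kap_ne hqc _ _)), one_smul]
      · simp
      · simp only [Pi.add_apply, Pi.single_eq_same]
        rw [← Nat.mod_add_mod, Nat.mod_eq_of_lt hs]
        omega
    · rw [XX_pow_zero _ _ _ ham (by omega), map_zero, map_zero]
      have hle : a m - s ≤ u m % a m := by omega
      have hle' : a m - s ≤ u m := hle.trans (Nat.mod_le _ _)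
      have hmod : (u m - (a m - s)) % a m + (a m - s) < a m := by
        have : u m - (a m - s) = (u m % a m - (a m - s)) + a m * (u m / a m) := by
          have := Nat.mod_add_div (u m) (a m); omega
        rw [this, Nat.add_mul_mod_self_left, Nat.mod_eq_of_lt (by omega)]
        omega
      have := hm (Finsupp.single (u - Pi.single m (a m - s)) 1)
      rw [XX_pow _ _ _ (by simpa using hmod), map_smul] at this
      have h0 := (smul_eq_zero.1 this).resolve_left (pow_ne_zero _ (kap_ne hqc _ _))
      rw [← h0]
      congr 2
      funext x
      by_cases hx : x = m
      · subst hx; simp; omega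
      · simp [hx]

variable (q a) in
/-- ordered monomials -/
def bm (u : Fin c → ℕ) : QQ q a := ((List.finRange c).map fun l => gx q a l ^ u l).prod

lemma gx_mul_pow (i h : Fin c) (n : ℕ) :
    gx q a i * gx q a h ^ n = q i h ^ n • (gx q a h ^ n * gx q a i) := by
  induction n with
  | zero => simp
  | succ n ih =>
    rw [pow_succ, ← mul_assoc, ih, smul_mul_assoc, mul_assoc, gx_comm, mul_smul_comm, smul_smul,
      ← pow_succ, mul_assoc]

lemma gx_mul_list (i : Fin c) (u : Fin c → ℕ) (l : List (Fin c)) (hs : l.Pairwise (· < ·)) (hi : i ∈ l) :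
    gx q a i * (l.map fun l => gx q a l ^ u l).prod =
      (l.map fun l => if l < i then q i l ^ u l else 1).prod •
        (l.map fun l => gx q a l ^ (u + Pi.single i 1 : Fin c → ℕ) l).prod := by
  induction l with
  | nil => simp at hi
  | cons h t ih =>
    rw [List.pairwise_cons] at hs
    simp only [List.map_cons, List.prod_cons]
    by_cases hh : i = h
    · subst hh
      have e1 : (t.map fun l => if l < i then q i l ^ u l else (1:k)).prod = 1 := by
        apply List.prod_eq_one
        intro x hx
        obtain ⟨y, hy, rfl⟩ := List.mem_map.1 hx
        rw [if_neg (hs.1 y hy).asymm]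
      have e2 : (t.map fun l => gx q a l ^ (u + Pi.single i 1 : Fin c → ℕ) l)
          = t.map fun l => gx q a l ^ u l := by
        apply List.map_congr_left
        intro y hy
        have : y ≠ i := (hs.1 y hy).ne'
        simp [this]
      rw [e1, e2, if_neg (lt_irrefl _), ← mul_assoc, ← pow_succ']
      simp
    · have hit : i ∈ t := by
        rcases List.mem_cons.1 hi with h' | h'
        · exact absurd h' hh
        · exact h'
      have hlt := hs.1 i hit
      have hhi : h ≠ i := fun e => hh e.symm
      rw [← mul_assoc, gx_mul_pow, smul_mul_assoc, mul_assoc, ih hs.2 hit, if_pos hlt, mul_smul_comm,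
        smul_smul]
      simp [hhi]

lemma gx_mul_bm (i : Fin c) (u : Fin c → ℕ) :
    gx q a i * bm q a u = kap q i u • bm q a (u + Pi.single i 1) := by
  unfold bm
  rw [gx_mul_list i u _ (List.pairwise_lt_finRange c) (List.mem_finRange i), kap, Fin.prod_univ_def]

lemma bm_zero : bm q a 0 = 1 := by
  unfold bm
  apply List.prod_eq_one
  simp

lemma bm_eq_zero (u : Fin c → ℕ) (i : Fin c) (h : a i ≤ u i) : bm q a u = 0 := by
  unfold bm
  apply List.prod_eq_zero
  refine List.mem_map.2 ⟨i, List.mem_finRange i, ?_⟩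
  rw [← Nat.sub_add_cancel h, pow_add, gx_pow, mul_zero]

/-- the model module -/
structure Params (q : Fin c → Fin c → k) (a : Fin c → ℕ) : Prop where
  hqd : ∀ i, q i i = 1
  hqc : ∀ i j, q i j * q j i = 1
  ha : ∀ i, 2 ≤ a i

/-- the action on the model -/
def modelHom0 (hp : Params q a) : QCI k c q a →ₐ[k] Module.End k ((Fin c → ℕ) →₀ k) :=
  RingQuot.liftAlgHom k ⟨FreeAlgebra.lift k (XX q a), by
    rintro x y (⟨i, rfl, rfl⟩ | ⟨i, j, rfl, rfl⟩)
    · rw [map_pow, FreeAlgebra.lift_ι_apply, XX_pow_a hp.ha, map_zero]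
    · rw [map_smul, map_mul, map_mul, FreeAlgebra.lift_ι_apply, FreeAlgebra.lift_ι_apply,
        XX_comm hp.hqd hp.hqc]⟩

/-- the action on the model -/
def modelHom (hp : Params q a) : QQ q a →ₐ[k] Module.End k ((Fin c → ℕ) →₀ k) := modelHom0 hp

lemma modelHom_gx (hp : Params q a) (i : Fin c) : modelHom hp (gx q a i) = XX q a i := by
  have : modelHom0 hp (RingQuot.mkAlgHom k (qciRel k c q a) (FreeAlgebra.ι k i)) = XX q a i := by
    unfold modelHom0
    rw [RingQuot.liftAlgHom_mkAlgHom_apply, FreeAlgebra.lift_ι_apply]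
  exact this

/-- the underlying space of the model -/
abbrev Mdl (k : Type) [Field k] (c : ℕ) : Type := (Fin c → ℕ) →₀ k

instance mdlMod [hp : Fact (Params q a)] : Module (QQ q a) (Mdl k c) :=
  Module.compHom ((Fin c → ℕ) →₀ k) (modelHom hp.out).toRingHom
lemma mdl_smul [hp : Fact (Params q a)] (b : QQ q a) (v : Mdl k c) :
    b • v = modelHom hp.out b v := rfl
instance mdlTower [hp : Fact (Params q a)] : IsScalarTower k (QQ q a) (Mdl k c) where
  smul_assoc r b v := by
    rw [mdl_smul, mdl_smul, map_smul]; rfl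

lemma mdl_gx [hp : Fact (Params q a)] (i : Fin c) (v : Mdl k c) : gx q a i • v = XX q a i v := by
  rw [mdl_smul, modelHom_gx]

lemma EV_model_trivial [hp : Fact (Params q a)] (N : Type) [AddCommGroup N] [Module k N]
    [Module (QQ q a) N] [IsScalarTower k (QQ q a) N] (hN : ∀ i (v : N), gx q a i • v = 0)
    (n : ℕ) : EV q a (Mdl k c) N n := by
  have hR : ∀ (m : Fin c) (s : ℕ) (f : Mdl k c →ₗ[k] N) (v : Mdl k c),
      ((homQS q a (Mdl k c) N).R m ^ s) f v = f ((XX q a m ^ s) v) := by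
    intro m s f
    induction s with
    | zero => intro v; rfl
    | succ s ih =>
      intro v
      rw [pow_succ', Module.End.mul_apply, homQS_R, mdl_gx, ih, pow_succ, Module.End.mul_apply]
  refine QS.acyclic _ hp.out.hqc hp.out.ha (fun i => ?_) (fun m s h1 h2 f hf hfm => ?_) n
  · ext f v; exact hN i _
  · obtain ⟨g, hg1, hg2⟩ := model_exact hp.out.hqc hp.out.ha m s h1 h2 f
      (fun l hl v => by
        have := LinearMap.congr_fun (hf l hl) v
        rw [homQS_R, mdl_gx] at this
        exact this)
      (fun v => by
        have := LinearMap.congr_fun hfm v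
        rw [hR] at this
        exact this)
    refine ⟨g, fun l hl => ?_, ?_⟩
    · apply LinearMap.ext
      intro v
      rw [homQS_R, mdl_gx]
      exact hg1 l hl v
    · apply LinearMap.ext
      intro v
      rw [hR]
      exact hg2 v

/-- a k-linear map commuting with the generators is linear -/
def mkLin {M N : Type} [AddCommGroup M] [AddCommGroup N] [Module k M] [Module k N]
  [Module (QQ q a) M] [Module (QQ q a) N]
  [IsScalarTower k (QQ q a) M] [IsScalarTower k (QQ q a) N] (f : M →ₗ[k] N)
    (h : ∀ i v, f (gx q a i • v) = gx q a i • f v) : M →ₗ[QQ q a] N :=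
  toLin (f := f) (by
    rw [QS.HZ_iff]
    intro i
    ext v
    exact (h i v).symm)

/-- projection from the model to the algebra -/
def rho [hp : Fact (Params q a)] : Mdl k c →ₗ[QQ q a] QQ q a :=
  mkLin (M := Mdl k c) (Finsupp.lsum k fun u => LinearMap.toSpanSingleton k _ (bm q a u)) (by
    intro i
    have : (Finsupp.lsum k fun u => LinearMap.toSpanSingleton k _ (bm q a u)) ∘ₗ XX q a i =
      LinearMap.mulLeft k (gx q a i) ∘ₗ
        (Finsupp.lsum k fun u => LinearMap.toSpanSingleton k _ (bm q a u)) := by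
      apply lin_ext
      intro u
      simp only [LinearMap.comp_apply, XX_single, LinearMap.mulLeft_apply]
      simp only [Finsupp.lsum_single, LinearMap.toSpanSingleton_apply, one_smul]
      rw [gx_mul_bm]
      split_ifs with h
      · rw [map_zero, bm_eq_zero _ i, smul_zero]
        simpa using Nat.le_of_dvd (Nat.succ_pos _) h
      · simp
    intro v
    rw [mdl_gx]
    exact LinearMap.congr_fun this v)

lemma rho_single [hp : Fact (Params q a)] (u : Fin c → ℕ) (r : k) :
    rho (q := q) (a := a) (Finsupp.single u r : (Fin c → ℕ) →₀ k) = r • bm q a u := by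
  change (Finsupp.lsum k fun u => LinearMap.toSpanSingleton k _ (bm q a u)) (Finsupp.single u r) = _
  simp

/-- inclusion of the algebra in the model -/
def theta [hp : Fact (Params q a)] : QQ q a →ₗ[QQ q a] Mdl k c :=
  LinearMap.toSpanSingleton _ _ (Finsupp.single 0 1 : (Fin c → ℕ) →₀ k)

lemma rho_theta [hp : Fact (Params q a)] (b : QQ q a) : rho (q := q) (a := a) (theta (q := q) (a := a) b) = b := by
  unfold theta
  rw [LinearMap.toSpanSingleton_apply, map_smul, rho_single, bm_zero]
  simp

lemma finite_qci [hp : Fact (Params q a)] : Module.Finite k (QQ q a) := by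
  have hsurj : Function.Surjective ((rho (q := q) (a := a)).restrictScalars k) := fun b => ⟨_, rho_theta (q := q) (a := a) b⟩
  have hfin : (Set.range fun u : (∀ i, Fin (a i)) => bm q a (fun i => (u i : ℕ))).Finite :=
    Set.finite_range _
  refine ⟨?_⟩
  have : (⊤ : Submodule k (QQ q a)) =
      Submodule.span k (Set.range fun u : (∀ i, Fin (a i)) => bm q a (fun i => (u i : ℕ))) := by
    symm
    rw [eq_top_iff]
    rintro b -
    obtain ⟨v, rfl⟩ := hsurj b
    change rho (q := q) (a := a) v ∈ _
    induction v using Finsupp.induction_linear with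
    | zero => rw [show rho (q := q) (a := a) (0 : (Fin c → ℕ) →₀ k) = 0 from map_zero (rho (q := q) (a := a))]; exact zero_mem _
    | add f g hf hg =>
      rw [show rho (q := q) (a := a) (f + g : (Fin c → ℕ) →₀ k) = rho (q := q) (a := a) f + rho (q := q) (a := a) g from map_add (rho (q := q) (a := a)) _ _]
      exact add_mem hf hg
    | single u r =>
      rw [rho_single]
      apply Submodule.smul_mem
      by_cases h : ∀ i, u i < a i
      · exact Submodule.subset_span ⟨fun i => ⟨u i, h i⟩, rfl⟩
      · push Not at h
        obtain ⟨i, hi⟩ := h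
        rw [bm_eq_zero _ i hi]
        exact zero_mem _
  rw [this]
  exact Submodule.fg_span hfin

end Model

end QCIaux

namespace QCIaux

/-! ### Acyclicity for projective modules -/
section Proj

variable {k : Type} [Field k] {c : ℕ} {q : Fin c → Fin c → k} {a : Fin c → ℕ}

variable {N : Type} [AddCommGroup N] [Module k N]
    [Module (QQ q a) N] [IsScalarTower k (QQ q a) N]

/-- the submodule of multiples of a generator -/
def xSub (m : Fin c) (N : Type) [AddCommGroup N] [Module k N]
    [Module (QQ q a) N] [IsScalarTower k (QQ q a) N] : Submodule (QQ q a) N where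
  carrier := {v | ∃ w, v = gx q a m • w}
  zero_mem' := ⟨0, by simp⟩
  add_mem' := by
    rintro _ _ ⟨v, rfl⟩ ⟨w, rfl⟩
    exact ⟨v + w, by simp⟩
  smul_mem' := by
    intro b
    induction b using gx_induct with
    | alg r =>
      rintro _ ⟨w, rfl⟩
      exact ⟨r • w, by rw [algebraMap_smul, smul_algebra_smul_comm]⟩
    | gen i =>
      rintro _ ⟨w, rfl⟩
      refine ⟨q i m • gx q a i • w, ?_⟩
      rw [smul_smul, gx_comm, smul_algebra_smul_comm, smul_assoc, mul_smul]
    | mul x y hx hy =>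
      intro v hv
      rw [mul_smul]
      exact hx (hy hv)
    | hadd x y hx hy =>
      intro v hv
      rw [add_smul]
      obtain ⟨w, hw⟩ := hx hv
      obtain ⟨z, hz⟩ := hy hv
      exact ⟨w + z, by rw [hw, hz, smul_add]⟩

lemma ses_sub (M : Type) [AddCommGroup M] [Module k M]
    [Module (QQ q a) M] [IsScalarTower k (QQ q a) M] (K : Submodule (QQ q a) N) :
    SES (CT q a M K) (CT q a M N) (CT q a M (N ⧸ K)) (post M K.subtype).toAddMonoidHom
      (post M K.mkQ).toAddMonoidHom :=
  ses_post M K.subtype K.mkQ (Submodule.subtype_injective K) (Submodule.mkQ_surjective K) (by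
    intro y
    simp)

lemma EV_model (hp : Params q a) [Fact (Params q a)] (n : ℕ) (N : Type) [AddCommGroup N] [Module k N]
    [Module (QQ q a) N] [IsScalarTower k (QQ q a) N] : EV q a (Mdl k c) N n := by
  have main : ∀ m ≤ c, ∀ (N : Type) [AddCommGroup N] [Module k N]
      [Module (QQ q a) N] [IsScalarTower k (QQ q a) N],
      (∀ l : Fin c, m ≤ l.1 → ∀ v : N, gx q a l • v = 0) → EV q a (Mdl k c) N n := by
    intro m
    induction m with
    | zero =>
      intro _ N _ _ _ _ h
      exact EV_model_trivial N (fun i v => h i (Nat.zero_le _) v) n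
    | succ m ih =>
      intro hm N _ _ _ _ h
      let m' : Fin c := ⟨m, hm⟩
      have main2 : ∀ (t : ℕ) (N : Type) [AddCommGroup N] [Module k N]
          [Module (QQ q a) N] [IsScalarTower k (QQ q a) N],
          (∀ l : Fin c, m + 1 ≤ l.1 → ∀ v : N, gx q a l • v = 0) →
          (∀ v : N, gx q a m' ^ t • v = 0) → EV q a (Mdl k c) N n := by
        intro t
        induction t with
        | zero =>
          intro N _ _ _ _ h h0
          have : Subsingleton N := ⟨fun v w => by
            have h1 := h0 v
            have h2 := h0 w
            rw [pow_zero, one_smul] at h1 h2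
            rw [h1, h2]⟩
          exact EV_zero_of_subsingleton n
        | succ t iht =>
          intro N _ _ _ _ h h0
          refine (ses_sub (Mdl k c) (xSub (a := a) m' N)).les_mid (QS.isMC _ hp.hqc hp.ha) ?_ ?_
          · refine iht _ ?_ ?_
            · rintro l hl ⟨v, hv⟩
              exact Subtype.ext (h l hl v)
            · rintro ⟨v, w, rfl⟩
              apply Subtype.ext
              change gx q a m' ^ t • gx q a m' • w = 0
              rw [smul_smul, ← pow_succ, h0]
          · refine ih (by omega) _ ?_
            intro l hl v
            obtain ⟨v, rfl⟩ := Submodule.mkQ_surjective _ v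
            rw [← map_smul]
            by_cases hlm : m + 1 ≤ l.1
            · rw [h l hlm, map_zero]
            · have : l = m' := Fin.ext (by simp only [m']; omega)
              subst this
              rw [Submodule.mkQ_apply, Submodule.Quotient.mk_eq_zero]
              exact ⟨v, rfl⟩
      refine main2 (a m') N h ?_
      intro v
      rw [gx_pow, zero_smul]
  exact main c le_rfl N (fun l hl => absurd l.2 (by omega))

lemma EV_self (hp : Params q a) (n : ℕ) (N : Type) [AddCommGroup N] [Module k N]
    [Module (QQ q a) N] [IsScalarTower k (QQ q a) N] : EV q a (QQ q a) N n := by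
  have : Fact (Params q a) := ⟨hp⟩
  refine HV_retract (inter_pre (N := N) (rho (q := q) (a := a))) (inter_pre (N := N) theta) ?_
    (EV_model hp n N)
  intro f
  ext b
  exact congrArg f (rho_theta b)

lemma EV_free (hp : Params q a) (n : ℕ) (ι N : Type) [AddCommGroup N] [Module k N]
    [Module (QQ q a) N] [IsScalarTower k (QQ q a) N] :
    EV q a (ι →₀ QQ q a) N n := by
  refine HV_prod (fun x => (pre N (Finsupp.lsingle (R := QQ q a) x)).toAddMonoidHom)
    (fun x => inter_pre (N := N) (Finsupp.lsingle (R := QQ q a) x)) ?_ ?_ (fun x => EV_self hp n N)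
  · intro w
    refine ⟨Finsupp.lsum k w, fun x => ?_⟩
    ext b
    change Finsupp.lsum k w (Finsupp.single x b) = _
    simp
  · intro v w h
    apply Finsupp.lhom_ext
    intro x b
    exact LinearMap.congr_fun (h x) b

lemma EV_proj (hp : Params q a) (n : ℕ) (P N : Type) [AddCommGroup N] [Module k N]
    [Module (QQ q a) N] [IsScalarTower k (QQ q a) N] [AddCommGroup P] [Module k P]
    [Module (QQ q a) P] [IsScalarTower k (QQ q a) P] [Module.Projective (QQ q a) P] :
    EV q a P N n := by
  obtain ⟨s, hs⟩ := Module.projective_def'.1 (inferInstance : Module.Projective (QQ q a) P)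
  refine HV_retract (inter_pre (N := N) (Finsupp.linearCombination (QQ q a) (id : P → P)))
    (inter_pre (N := N) s) ?_ (EV_free hp n P N)
  intro f
  ext b
  exact congrArg f (LinearMap.congr_fun hs b)

end Proj

end QCIaux

namespace QCIaux

/-! ### Duality over a symmetric algebra -/
section Dual

variable {k A : Type} [Field k] [Ring A] [Algebra k A]

lemma dual_lift [Module.Finite k A] (φ : A →ₗ[k] k) (h3 : ∀ y : A, (∀ x : A, φ (x * y) = 0) → y = 0)
    {X : Type} [AddCommGroup X] [Module k X] [Module A X] [IsScalarTower k A X] (l : X →ₗ[k] k) :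
    ∃ g : X →ₗ[A] A, ∀ x, φ (g x) = l x := by
  let B : A →ₗ[k] (A →ₗ[k] k) := (LinearMap.mul k A).flip.compr₂ φ
  have hB : ∀ y x, B y x = φ (x * y) := fun y x => rfl
  have hinj : Function.Injective B := by
    rw [injective_iff_map_eq_zero]
    intro y hy
    exact h3 y fun x => by rw [← hB, hy]; rfl
  have hsurj : Function.Surjective B := by
    refine (LinearMap.injective_iff_surjective_of_finrank_eq_finrank ?_).1 hinj
    exact (Subspace.dual_finrank_eq (K := k) (V := A)).symm
  have hl : ∀ x : X, ∃ y : A, ∀ b, φ (b * y) = l (b • x) := by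
    intro x
    obtain ⟨y, hy⟩ := hsurj (l ∘ₗ (LinearMap.toSpanSingleton A X x).restrictScalars k)
    refine ⟨y, fun b => ?_⟩
    rw [← hB, hy]; rfl
  choose g hg using hl
  have huniq : ∀ y z : A, (∀ b, φ (b * y) = φ (b * z)) → y = z := by
    intro y z h
    rw [← sub_eq_zero]
    apply h3
    intro b
    rw [mul_sub, map_sub, h, sub_self]
  refine ⟨⟨⟨g, ?_⟩, ?_⟩, ?_⟩
  · intro x y
    apply huniq
    intro b
    rw [hg, mul_add, map_add, hg, hg, smul_add, map_add]
  · intro d x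
    apply huniq
    intro b
    dsimp only [RingHom.id_apply]
    rw [hg, smul_eq_mul, ← mul_assoc, hg, mul_smul]
  · intro x
    have := hg x 1
    rw [one_mul, one_smul] at this
    exact this

variable (φ : A →ₗ[k] k)

/-- the trace of an endomorphism of a free module -/
def tr {r : ℕ} (α : (Fin r → A) →ₗ[A] (Fin r → A)) : k := ∑ i, φ (α (Pi.single i 1) i)

lemma tr_comm (h1 : ∀ x y : A, φ (x * y) = φ (y * x)) {r s : ℕ}
    (α : (Fin s → A) →ₗ[A] (Fin r → A)) (β : (Fin r → A) →ₗ[A] (Fin s → A)) :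
    tr φ (α ∘ₗ β) = tr φ (β ∘ₗ α) := by
  have key : ∀ {r s : ℕ} (α : (Fin s → A) →ₗ[A] (Fin r → A)) (v : Fin s → A) (i : Fin r),
      α v i = ∑ j, v j * α (Pi.single j 1) i := by
    intro r s α v i
    conv_lhs => rw [pi_eq_sum_univ' v]
    rw [map_sum, Finset.sum_apply]
    refine Finset.sum_congr rfl fun j _ => ?_
    rw [map_smul, Pi.smul_apply, smul_eq_mul]
  unfold tr
  simp only [LinearMap.comp_apply]
  have e1 : ∀ i, φ (α (β (Pi.single i 1)) i) = ∑ j, φ (β (Pi.single i 1) j * α (Pi.single j 1) i) := by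
    intro i; rw [key α, map_sum]
  have e2 : ∀ j, φ (β (α (Pi.single j 1)) j) = ∑ i, φ (α (Pi.single j 1) i * β (Pi.single i 1) j) := by
    intro i; rw [key β, map_sum]
  simp only [e1, e2]
  rw [Finset.sum_comm]
  refine Finset.sum_congr rfl fun j _ => Finset.sum_congr rfl fun i _ => h1 _ _

end Dual

section Dual2

variable {k : Type} [Field k] {c : ℕ} {q : Fin c → Fin c → k} {a : Fin c → ℕ}

lemma ext_self (hp : Params q a) (φ : QQ q a →ₗ[k] k)
    (h3 : ∀ y : QQ q a, (∀ x, φ (x * y) = 0) → y = 0) {Z P : Type} [AddCommGroup Z] [AddCommGroup P]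
    [Module k Z] [Module k P] [Module (QQ q a) Z] [Module (QQ q a) P]
    [IsScalarTower k (QQ q a) Z] [IsScalarTower k (QQ q a) P] (i : Z →ₗ[QQ q a] P)
    (hi : Function.Injective i) : ExtLin (QQ q a) i := by
  have : Fact (Params q a) := ⟨hp⟩
  have := finite_qci (q := q) (a := a)
  intro f
  obtain ⟨r, hr⟩ := LinearMap.exists_leftInverse_of_injective (i.restrictScalars k)
      (LinearMap.ker_eq_bot.2 hi)
  have hr' : ∀ z, r (i z) = z := fun z => LinearMap.congr_fun hr z
  obtain ⟨g, hg⟩ := dual_lift φ h3 (X := P) (φ ∘ₗ f.restrictScalars k ∘ₗ r)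
  refine ⟨g, fun z => ?_⟩
  rw [← sub_eq_zero]
  apply h3
  intro b
  rw [mul_sub, ← smul_eq_mul, ← smul_eq_mul, ← map_smul, ← map_smul, ← map_smul, map_sub, hg]
  change φ (f (r (i _))) - _ = 0
  rw [hr', sub_self]

lemma ext_pi (hp : Params q a) (φ : QQ q a →ₗ[k] k)
    (h3 : ∀ y : QQ q a, (∀ x, φ (x * y) = 0) → y = 0) {Z P : Type} [AddCommGroup Z] [AddCommGroup P]
    [Module k Z] [Module k P] [Module (QQ q a) Z] [Module (QQ q a) P]
    [IsScalarTower k (QQ q a) Z] [IsScalarTower k (QQ q a) P] (i : Z →ₗ[QQ q a] P)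
    (hi : Function.Injective i) (r : ℕ) : ExtLin (Fin r → QQ q a) i := by
  intro f
  choose g hg using fun x : Fin r => ext_self hp φ h3 i hi (LinearMap.proj x ∘ₗ f)
  exact ⟨LinearMap.pi g, fun z => funext fun x => hg x z⟩

lemma ker_he {R P X : Type} [Ring R] [AddCommGroup P] [AddCommGroup X] [Module R P] [Module R X]
    (p : P →ₗ[R] X) (y : P) : p y = 0 ↔ ∃ z, (LinearMap.ker p).subtype z = y :=
  ⟨fun h => ⟨⟨y, h⟩, rfl⟩, by rintro ⟨z, rfl⟩; exact z.2⟩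

section Ker
variable {P X N : Type} [AddCommGroup P] [AddCommGroup X] [AddCommGroup N]
    [Module k P] [Module k X] [Module k N] [Module (QQ q a) P] [Module (QQ q a) X] [Module (QQ q a) N]
    [IsScalarTower k (QQ q a) P] [IsScalarTower k (QQ q a) X] [IsScalarTower k (QQ q a) N]

lemma shift_zero_ker (hp : Params q a) (p : P →ₗ[QQ q a] X) (hps : Function.Surjective p)
    (hP : EV q a P N 0) : EV q a X N 0 ↔ ExtLin N (LinearMap.ker p).subtype :=
  shift_zero hp.hqc hp.ha (LinearMap.ker p).subtype p (Submodule.subtype_injective (LinearMap.ker p))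
    hps (ker_he p) hP

lemma shift_succ_ker (hp : Params q a) (p : P →ₗ[QQ q a] X) (hps : Function.Surjective p)
    (hP : ∀ n, EV q a P N n) (n : ℕ) : EV q a X N (n + 1) ↔ EV q a (LinearMap.ker p) N n :=
  shift_succ hp.hqc hp.ha (LinearMap.ker p).subtype p (Submodule.subtype_injective (LinearMap.ker p))
    hps (ker_he p) hP n

lemma shift_cov_ker (hp : Params q a) (p : P →ₗ[QQ q a] X) (hps : Function.Surjective p)
    (hP : ∀ n, EV q a N P n) (n : ℕ) : EV q a N (LinearMap.ker p) (n + 1) ↔ EV q a N X n :=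
  shift_cov hp.hqc hp.ha (LinearMap.ker p).subtype p (Submodule.subtype_injective (LinearMap.ker p))
    hps (ker_he p) hP n
end Ker

lemma EV_inj (hp : Params q a) (φ : QQ q a →ₗ[k] k)
    (h3 : ∀ y : QQ q a, (∀ x, φ (x * y) = 0) → y = 0) (r n : ℕ) :
    ∀ (M : Type) [AddCommGroup M] [Module k M] [Module (QQ q a) M] [IsScalarTower k (QQ q a) M],
      EV q a M (Fin r → QQ q a) n := by
  induction n with
  | zero =>
    intro M _ _ _ _
    obtain ⟨p, hps⟩ : ∃ p : (M →₀ QQ q a) →ₗ[QQ q a] M, Function.Surjective p :=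
      ⟨Finsupp.linearCombination (QQ q a) id, Finsupp.linearCombination_id_surjective _ _⟩
    refine (shift_zero_ker hp p hps (EV_free hp 0 M _)).2 ?_
    exact ext_pi hp φ h3 _ (Submodule.subtype_injective _) r
  | succ n ih =>
    intro M _ _ _ _
    obtain ⟨p, hps⟩ : ∃ p : (M →₀ QQ q a) →ₗ[QQ q a] M, Function.Surjective p :=
      ⟨Finsupp.linearCombination (QQ q a) id, Finsupp.linearCombination_id_surjective _ _⟩
    exact (shift_succ_ker hp p hps (fun n => EV_free hp n M _) n).2 (ih _)

/-- eventual vanishing -/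
def EVev (q : Fin c → Fin c → k) (a : Fin c → ℕ) (M N : Type) [AddCommGroup M] [AddCommGroup N]
    [Module k M] [Module k N] [Module (QQ q a) M] [Module (QQ q a) N]
    [IsScalarTower k (QQ q a) M] [IsScalarTower k (QQ q a) N] : Prop :=
  ∃ n₀, ∀ n ≥ n₀, EV q a M N n

variable {M N : Type} [AddCommGroup M] [AddCommGroup N]
    [Module k M] [Module k N] [Module (QQ q a) M] [Module (QQ q a) N]
    [IsScalarTower k (QQ q a) M] [IsScalarTower k (QQ q a) N]

lemma EVev_ker (hp : Params q a) (φ : QQ q a →ₗ[k] k)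
    (h3 : ∀ y : QQ q a, (∀ x, φ (x * y) = 0) → y = 0) {r : ℕ} (p : (Fin r → QQ q a) →ₗ[QQ q a] N)
    (hps : Function.Surjective p) (h : EVev q a M N) : EVev q a M (LinearMap.ker p) := by
  obtain ⟨n₀, h⟩ := h
  refine ⟨n₀ + 1, fun n hn => ?_⟩
  obtain ⟨m, rfl⟩ : ∃ m, n = m + 1 := ⟨n - 1, by omega⟩
  exact (shift_cov_ker hp p hps (fun n => EV_inj hp φ h3 r n M) m).2 (h m (by omega))

lemma noeth (hp : Params q a) : IsNoetherianRing (QQ q a) := by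
  have : Fact (Params q a) := ⟨hp⟩
  have := finite_qci (q := q) (a := a)
  exact isNoetherian_of_tower k (inferInstance : IsNoetherian k (QQ q a))

lemma dual_zero (hp : Params q a) (hroot : ∀ i j, ∃ n : ℕ, 0 < n ∧ q i j ^ n = 1)
    (φ : QQ q a →ₗ[k] k) (h1 : ∀ x y, φ (x * y) = φ (y * x))
    (h3 : ∀ y : QQ q a, (∀ x, φ (x * y) = 0) → y = 0) [Module.Finite (QQ q a) N]
    (h : EVev q a M N) : EV q a N M 0 := by
  have : Fact (Params q a) := ⟨hp⟩
  have := finite_qci (q := q) (a := a)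
  have := noeth hp
  obtain ⟨r0, p0, hp0⟩ := Module.Finite.exists_fin' (QQ q a) N
  obtain ⟨r1, p1, hp1⟩ := Module.Finite.exists_fin' (QQ q a) (LinearMap.ker p0)
  obtain ⟨r2, p2, hp2⟩ := Module.Finite.exists_fin' (QQ q a) (LinearMap.ker p1)
  have hev := EVev_ker hp φ h3 p2 hp2 (EVev_ker hp φ h3 p1 hp1 (EVev_ker hp φ h3 p0 hp0 h))
  have hev0 : EV q a M (LinearMap.ker p2) 0 := QS.HV_all _ hp.hqc hp.ha hroot hev 0
  have hlift := (lift_iff_lift p2).1 ((ses_post M (LinearMap.ker p2).subtype p2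
    (Submodule.subtype_injective (LinearMap.ker p2)) hp2 (ker_he p2)).les_a (QS.isMC _ hp.hqc hp.ha) hev0)
  refine (shift_zero_ker hp p0 hp0 (EV_proj hp 0 _ _)).2 ?_
  intro g'
  let g : (Fin r1 → QQ q a) →ₗ[QQ q a] M := g' ∘ₗ p1
  let hh1 : (Fin r1 → QQ q a) →ₗ[QQ q a] (Fin r0 → QQ q a) := (LinearMap.ker p0).subtype ∘ₗ p1
  let hh2 : (Fin r2 → QQ q a) →ₗ[QQ q a] (Fin r1 → QQ q a) := (LinearMap.ker p1).subtype ∘ₗ p2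
  suffices hmain : ∃ e : (Fin r0 → QQ q a) →ₗ[QQ q a] M, e ∘ₗ hh1 = g by
    obtain ⟨e, he⟩ := hmain
    refine ⟨e, fun z => ?_⟩
    obtain ⟨y, rfl⟩ := hp1 z
    exact LinearMap.congr_fun he y
  -- the evaluation on the basis
  let W : Submodule k (Fin r1 → M) :=
    { carrier := {w | ∃ e : (Fin r0 → QQ q a) →ₗ[QQ q a] M, ∀ i, w i = e (hh1 (Pi.single i 1))}
      zero_mem' := ⟨0, fun i => rfl⟩
      add_mem' := by
        rintro v w ⟨e, he⟩ ⟨f, hf⟩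
        exact ⟨e + f, fun i => by rw [Pi.add_apply, he, hf]; rfl⟩
      smul_mem' := by
        rintro r w ⟨e, he⟩
        refine ⟨e ∘ₗ Module.toModuleEnd (QQ q a) (S := k) (Fin r0 → QQ q a) r, fun i => ?_⟩
        rw [Pi.smul_apply, he]
        change r • e _ = e (r • _)
        rw [LinearMap.map_smul_of_tower] }
  have hbasis : ∀ (f f' : (Fin r1 → QQ q a) →ₗ[QQ q a] M),
      (∀ i, f (Pi.single i 1) = f' (Pi.single i 1)) → f = f' := by
    intro f f' hf
    apply LinearMap.pi_ext'
    intro i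
    apply LinearMap.ext_ring
    exact hf i
  by_cases hgW : (fun i => g (Pi.single i 1)) ∈ W
  · obtain ⟨e, he⟩ := hgW
    exact ⟨e, (hbasis _ _ he).symm⟩
  exfalso
  obtain ⟨l, hl0, hlW⟩ := Submodule.exists_le_ker_of_notMem hgW
  -- lift the functional
  choose f hf using fun i : Fin r1 => dual_lift φ h3 (X := M) (l ∘ₗ LinearMap.single k (fun _ => M) i)
  have hlsum : ∀ w : Fin r1 → M, l w = ∑ i, φ (f i (w i)) := by
    intro w
    simp only [hf]
    have : w = ∑ i, Pi.single i (w i) := (Finset.univ_sum_single w).symm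
    conv_lhs => rw [this, map_sum]
    rfl
  let ff : M →ₗ[QQ q a] (Fin r1 → QQ q a) := LinearMap.pi f
  have hpair : ∀ g : (Fin r1 → QQ q a) →ₗ[QQ q a] M,
      l (fun i => g (Pi.single i 1)) = tr φ (ff ∘ₗ g) := fun g => hlsum _
  have hzero : ∀ e : (Fin r0 → QQ q a) →ₗ[QQ q a] M, tr φ ((hh1 ∘ₗ ff) ∘ₗ e) = 0 := by
    intro e
    rw [LinearMap.comp_assoc, tr_comm φ h1, LinearMap.comp_assoc, ← hpair]
    exact hlW ⟨e, fun i => rfl⟩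
  have hcomp : ∀ m, hh1 (ff m) = 0 := by
    have hφ : ∀ (m : M) (j : Fin r0), φ (hh1 (ff m) j) = 0 := by
      intro m j
      have := hzero ((LinearMap.toSpanSingleton (QQ q a) M m) ∘ₗ LinearMap.proj j)
      unfold tr at this
      rw [Finset.sum_eq_single j] at this
      · simpa using this
      · intro i _ hij
        simp [Pi.single_apply, hij.symm]
      · simp
    intro m
    funext j
    apply h3
    intro x
    have := hφ (x • m) j
    rw [map_smul, map_smul, Pi.smul_apply, smul_eq_mul] at this
    exact this
  have hker : ∀ m, p1 (ff m) = 0 := fun m => Subtype.ext (hcomp m)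
  obtain ⟨f', hf'⟩ := hlift (LinearMap.codRestrict (LinearMap.ker p1) ff hker)
  have hff : hh2 ∘ₗ f' = ff := by
    ext1 m
    exact congrArg Subtype.val (hf' m)
  apply hl0
  rw [hpair, ← hff, LinearMap.comp_assoc, tr_comm φ h1, LinearMap.comp_assoc]
  have : g ∘ₗ hh2 = 0 := by
    refine LinearMap.ext fun m => ?_
    change g' (p1 (p2 m)) = 0
    rw [LinearMap.mem_ker.1 (p2 m).2, map_zero]
  rw [this, LinearMap.comp_zero]
  simp [tr]

lemma dual_all (hp : Params q a) (hroot : ∀ i j, ∃ n : ℕ, 0 < n ∧ q i j ^ n = 1)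
    (φ : QQ q a →ₗ[k] k) (h1 : ∀ x y, φ (x * y) = φ (y * x))
    (h3 : ∀ y : QQ q a, (∀ x, φ (x * y) = 0) → y = 0) (n : ℕ) :
    ∀ (N : Type) [AddCommGroup N] [Module k N] [Module (QQ q a) N]
      [IsScalarTower k (QQ q a) N] [Module.Finite (QQ q a) N],
      EVev q a M N → EV q a N M n := by
  have := noeth hp
  induction n with
  | zero => intro N _ _ _ _ _ h; exact dual_zero hp hroot φ h1 h3 h
  | succ n ih =>
    intro N _ _ _ _ _ h
    obtain ⟨r0, p0, hp0⟩ := Module.Finite.exists_fin' (QQ q a) N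
    exact (shift_succ_ker hp p0 hp0 (fun n => EV_proj hp n _ _) n).2 (ih _ (EVev_ker hp φ h3 p0 hp0 h))

end Dual2

end QCIaux

namespace QCIaux

/-! ### Link to `Ext` -/
section Link

lemma extVanish_iff (A : Type) [Ring A] (M N : Type) [AddCommGroup M] [Module A M]
    [AddCommGroup N] [Module A N] (P : ProjectiveResolution (ModuleCat.of A M)) (n : ℕ) :
    extVanish A M N (n + 1) ↔
      ∀ f : P.complex.X (n + 1) →ₗ[A] N, f ∘ₗ (P.complex.d (n + 2) (n + 1)).hom = 0 →
        ∃ g : P.complex.X n →ₗ[A] N, f = g ∘ₗ (P.complex.d (n + 1) n).hom := by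
  unfold extVanish
  rw [← ModuleCat.isZero_iff_subsingleton, (P.isoExt (n + 1) (ModuleCat.of A N)).isZero_iff,
    ← HomologicalComplex.exactAt_iff_isZero_homology,
    HomologicalComplex.exactAt_iff' _ n (n + 1) (n + 2) (by simp) (by simp),
    ShortComplex.moduleCat_exact_iff]
  constructor
  · intro h f hf
    obtain ⟨g, hg⟩ := h (ModuleCat.ofHom f : P.complex.X (n + 1) ⟶ ModuleCat.of A N)
      (ModuleCat.hom_ext hf)
    refine ⟨ModuleCat.Hom.hom (show P.complex.X n ⟶ ModuleCat.of A N from g), ?_⟩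
    exact (congrArg ModuleCat.Hom.hom hg).symm
  · intro h f hf
    obtain ⟨g, hg⟩ := h (ModuleCat.Hom.hom (show P.complex.X (n + 1) ⟶ ModuleCat.of A N from f))
      (congrArg ModuleCat.Hom.hom hf)
    exact ⟨(ModuleCat.ofHom g : P.complex.X n ⟶ ModuleCat.of A N), ModuleCat.hom_ext hg.symm⟩

variable {k : Type} [Field k] {c : ℕ} {q : Fin c → Fin c → k} {a : Fin c → ℕ}

lemma EV_res (hp : Params q a) (N : Type) [AddCommGroup N] [Module k N] [Module (QQ q a) N]
    [IsScalarTower k (QQ q a) N] (n : ℕ) :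
    ∀ (M : Type) [AddCommGroup M] [Module k M] [Module (QQ q a) M] [IsScalarTower k (QQ q a) M]
      (P : ℕ → Type) [∀ n, AddCommGroup (P n)] [∀ n, Module k (P n)] [∀ n, Module (QQ q a) (P n)]
      [∀ n, IsScalarTower k (QQ q a) (P n)] [∀ n, Module.Projective (QQ q a) (P n)]
      (d : ∀ n, P (n + 1) →ₗ[QQ q a] P n) (p : P 0 →ₗ[QQ q a] M) (_ : Function.Surjective p)
      (_ : ∀ y, p y = 0 ↔ ∃ z, d 0 z = y) (_ : ∀ n y, d n y = 0 ↔ ∃ z, d (n + 1) z = y),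
      EV q a M N n ↔ ∀ f : P (n + 1) →ₗ[QQ q a] N, f ∘ₗ d (n + 1) = 0 →
        ∃ g : P n →ₗ[QQ q a] N, f = g ∘ₗ d n := by
  induction n with
  | zero =>
    intro M _ _ _ _ P _ _ _ _ _ d p hps h0 hd
    rw [shift_zero_ker hp p hps (EV_proj hp 0 _ _)]
    let d' : P 1 →ₗ[QQ q a] LinearMap.ker p :=
      LinearMap.codRestrict (LinearMap.ker p) (d 0) fun z => (h0 _).2 ⟨z, rfl⟩
    have hd' : Function.Surjective d' := by
      rintro ⟨y, hy⟩
      obtain ⟨z, hz⟩ := (h0 y).1 hy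
      exact ⟨z, Subtype.ext hz⟩
    constructor
    · intro h f hf
      have hle : LinearMap.ker d' ≤ LinearMap.ker f := by
        intro y hy
        obtain ⟨z, rfl⟩ := (hd 0 y).1 (congrArg Subtype.val hy)
        exact LinearMap.congr_fun hf z
      obtain ⟨e, he⟩ : ∃ e : LinearMap.ker p →ₗ[QQ q a] N, ∀ y, e (d' y) = f y := by
        refine ⟨(LinearMap.ker d').liftQ f hle ∘ₗ
          (d'.quotKerEquivOfSurjective hd').symm.toLinearMap, fun y => ?_⟩
        have : (d'.quotKerEquivOfSurjective hd').symm (d' y) = Submodule.Quotient.mk y := by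
          rw [LinearEquiv.symm_apply_eq]; rfl
        rw [LinearMap.comp_apply, LinearEquiv.coe_coe, this]
        rfl
      obtain ⟨g, hg⟩ := h e
      refine ⟨g, LinearMap.ext fun y => ?_⟩
      rw [← he, ← hg]; rfl
    · intro h e
      obtain ⟨g, hg⟩ := h (e ∘ₗ d') (by
        refine LinearMap.ext fun y => ?_
        have : d' (d 1 y) = 0 := Subtype.ext ((hd 0 _).2 ⟨y, rfl⟩)
        change e (d' (d 1 y)) = 0
        rw [this, map_zero])
      refine ⟨g, fun z => ?_⟩
      obtain ⟨y, rfl⟩ := hd' z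
      exact (LinearMap.congr_fun hg y).symm
  | succ n ih =>
    intro M _ _ _ _ P _ _ _ _ _ d p hps h0 hd
    rw [shift_succ_ker hp p hps (fun n => EV_proj hp n _ _)]
    let d' : P 1 →ₗ[QQ q a] LinearMap.ker p :=
      LinearMap.codRestrict (LinearMap.ker p) (d 0) fun z => (h0 _).2 ⟨z, rfl⟩
    have hd' : Function.Surjective d' := by
      rintro ⟨y, hy⟩
      obtain ⟨z, hz⟩ := (h0 y).1 hy
      exact ⟨z, Subtype.ext hz⟩
    refine ih (LinearMap.ker p) (fun n => P (n + 1)) (fun n => d (n + 1)) d' hd' (fun y => ?_)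
      (fun n => hd (n + 1))
    rw [← hd 0 y]
    exact ⟨fun h => congrArg Subtype.val h, fun h => Subtype.ext h⟩

lemma ext_link (hp : Params q a) (M N : Type) [AddCommGroup M] [Module k M] [Module (QQ q a) M]
    [IsScalarTower k (QQ q a) M] [AddCommGroup N] [Module k N] [Module (QQ q a) N]
    [IsScalarTower k (QQ q a) N] (n : ℕ) : extVanish (QQ q a) M N (n + 1) ↔ EV q a M N n := by
  let P := projectiveResolution (ModuleCat.of (QQ q a) M)
  let _ : ∀ n, Module k (P.complex.X n) := fun n => Module.compHom _ (algebraMap k (QQ q a))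
  have : ∀ n, IsScalarTower k (QQ q a) (P.complex.X n) := fun n =>
    IsScalarTower.of_algebraMap_smul fun r x => rfl
  have : ∀ n, Module.Projective (QQ q a) (P.complex.X n) := fun n =>
    (IsProjective.iff_projective _).2 (P.projective n)
  let π0 : P.complex.X 0 ⟶ ModuleCat.of (QQ q a) M := P.π.f 0
  rw [extVanish_iff (QQ q a) M N P n]
  refine (EV_res hp N n M (fun n => P.complex.X n) (fun n => (P.complex.d (n + 1) n).hom)
    π0.hom ?_ ?_ ?_).symm
  · exact (ModuleCat.epi_iff_surjective (P.π.f 0)).1 inferInstance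
  · intro y
    constructor
    · exact fun h => (ShortComplex.moduleCat_exact_iff _).1 P.exact₀ y h
    · rintro ⟨z, rfl⟩
      exact LinearMap.congr_fun (congrArg ModuleCat.Hom.hom P.complex_d_comp_π_f_zero) z
  · intro n y
    constructor
    · exact fun h => (ShortComplex.moduleCat_exact_iff _).1 (P.exact_succ n) y h
    · rintro ⟨z, rfl⟩
      exact LinearMap.congr_fun (congrArg ModuleCat.Hom.hom (P.complex.d_comp_d (n+2) (n+1) n)) z

end Link

lemma main_aux {k : Type} [Field k] {c : ℕ} {q : Fin c → Fin c → k} {a : Fin c → ℕ}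
    (hp : Params q a) (hroot : ∀ i j, ∃ n : ℕ, 0 < n ∧ q i j ^ n = 1)
    (hsymm : IsSymmAlg k (QQ q a))
    (M N : Type) [AddCommGroup M] [Module (QQ q a) M] [Module.Finite (QQ q a) M]
    [AddCommGroup N] [Module (QQ q a) N] [Module.Finite (QQ q a) N] :
    List.TFAE
      [∃ n₀ : ℕ, ∀ i ≥ n₀, extVanish (QQ q a) M N i,
       ∀ i > 0, extVanish (QQ q a) M N i,
       ∃ n₀ : ℕ, ∀ i ≥ n₀, extVanish (QQ q a) N M i,
       ∀ i > 0, extVanish (QQ q a) N M i] := by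
  let _ : Module k M := Module.compHom _ (algebraMap k (QQ q a))
  let _ : Module k N := Module.compHom _ (algebraMap k (QQ q a))
  have : IsScalarTower k (QQ q a) M := IsScalarTower.of_algebraMap_smul fun r x => rfl
  have : IsScalarTower k (QQ q a) N := IsScalarTower.of_algebraMap_smul fun r x => rfl
  obtain ⟨φ, h1, -, h3⟩ := hsymm
  have hev : ∀ (M N : Type) [AddCommGroup M] [Module k M] [Module (QQ q a) M]
    [IsScalarTower k (QQ q a) M] [AddCommGroup N] [Module k N] [Module (QQ q a) N]
    [IsScalarTower k (QQ q a) N], (∃ n₀ : ℕ, ∀ i ≥ n₀, extVanish (QQ q a) M N i) →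
      EVev q a M N := by
    rintro M N _ _ _ _ _ _ _ _ ⟨n₀, h⟩
    exact ⟨n₀, fun n hn => (ext_link hp M N n).1 (h _ (by omega))⟩
  have hpos : ∀ (M N : Type) [AddCommGroup M] [Module k M] [Module (QQ q a) M]
    [IsScalarTower k (QQ q a) M] [AddCommGroup N] [Module k N] [Module (QQ q a) N]
    [IsScalarTower k (QQ q a) N], (∀ n, EV q a M N n) →
      ∀ i > 0, extVanish (QQ q a) M N i := by
    intro M N _ _ _ _ _ _ _ _ h i hi
    obtain ⟨n, rfl⟩ : ∃ n, i = n + 1 := ⟨i - 1, by omega⟩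
    exact (ext_link hp M N n).2 (h n)
  tfae_have 1 → 4 := fun h => hpos N M fun n => dual_all hp hroot φ h1 h3 n N (hev M N h)
  tfae_have 4 → 3 := fun h => ⟨1, fun i hi => h i (by omega)⟩
  tfae_have 3 → 2 := fun h => hpos M N fun n => dual_all hp hroot φ h1 h3 n M (hev N M h)
  tfae_have 2 → 1 := fun h => ⟨1, fun i hi => h i (by omega)⟩
  tfae_finish

end QCIaux

theorem ext_symmetry_of_symmetric_qci
    (k : Type) [Field k] (c : ℕ) (hc : 1 ≤ c)
    (q : Fin c → Fin c → k) (a : Fin c → ℕ)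
    (hqd : ∀ i, q i i = 1) (hqc : ∀ i j, q i j * q j i = 1) (ha : ∀ i, 2 ≤ a i)
    (hroot : ∀ i j, ∃ n : ℕ, 0 < n ∧ q i j ^ n = 1)
    (hsymm : IsSymmAlg k (QCI k c q a))
    (M N : Type) [AddCommGroup M] [Module (QCI k c q a) M] [Module.Finite (QCI k c q a) M]
    [AddCommGroup N] [Module (QCI k c q a) N] [Module.Finite (QCI k c q a) N] :
    List.TFAE
      [∃ n₀ : ℕ, ∀ i ≥ n₀, extVanish (QCI k c q a) M N i,
       ∀ i > 0, extVanish (QCI k c q a) M N i,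
       ∃ n₀ : ℕ, ∀ i ≥ n₀, extVanish (QCI k c q a) N M i,
       ∀ i > 0, extVanish (QCI k c q a) N M i] := by
  have h1 : IsSymmAlg k (QCIaux.QQ q a) := hsymm
  let i1 : Module (QCIaux.QQ q a) M := ‹Module (QCI k c q a) M›
  let i2 : Module (QCIaux.QQ q a) N := ‹Module (QCI k c q a) N›
  have f1 : Module.Finite (QCIaux.QQ q a) M := ‹Module.Finite (QCI k c q a) M›
  have f2 : Module.Finite (QCIaux.QQ q a) N := ‹Module.Finite (QCI k c q a) N›
  have := QCIaux.main_aux ⟨hqd, hqc, ha⟩ hroot h1 M N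
  exact this
end
end

section
/- Let A = A_q^a be a quantum complete intersection over a field k. Then A is selfinjective: A is injective as a left module over itself. -/
/-!
A quantum complete intersection `A_q^a` is selfinjective: it is injective as a left
module over itself.
-/

noncomputable section

namespace QCIAux

open Finset

variable {k : Type} [Field k] {c : ℕ}

/-- Unit vector. -/
abbrev dl (i : Fin c) : Fin c → ℕ := Pi.single i 1

/-- Commutation coefficient. -/
def C (q : Fin c → Fin c → k) (i : Fin c) (n : Fin c → ℕ) : k :=
  ∏ j, if j < i then q i j ^ n j else 1

lemma C_add (q : Fin c → Fin c → k) (i j : Fin c) (n : Fin c → ℕ) :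
    C q i (n + dl j) = C q i n * (if j < i then q i j else 1) := by
  have : (if j < i then q i j else 1) = ∏ l, if l = j then (if j < i then q i j else 1) else 1 := by
    simp
  rw [this, C, C, ← Finset.prod_mul_distrib]
  refine Finset.prod_congr rfl fun l _ => ?_
  by_cases h : l = j
  · subst h
    by_cases h2 : l < i <;> simp [h2, pow_succ]
  · simp [h]

lemma C_ne (q : Fin c → Fin c → k) (hqc : ∀ i j, q i j * q j i = 1) (i : Fin c) (n : Fin c → ℕ) :
    C q i n ≠ 0 := by
  refine Finset.prod_ne_zero_iff.2 fun j _ => ?_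
  split_ifs
  · exact pow_ne_zero _ (left_ne_zero_of_mul_eq_one (hqc i j))
  · exact one_ne_zero

lemma sub_add_dl (i : Fin c) (n : Fin c → ℕ) (h : 1 ≤ n i) : n - dl i + dl i = n := by
  funext l
  by_cases hl : l = i
  · subst hl; simp; omega
  · simp [hl]

/-- The operator of `x_i` on functions. -/
def X (q : Fin c → Fin c → k) (a : Fin c → ℕ) (i : Fin c) :
    Module.End k ((Fin c → ℕ) → k) where
  toFun f n := if 1 ≤ n i ∧ n i < a i then C q i n * f (n - dl i) else 0
  map_add' f g := by
    funext n
    by_cases h : 1 ≤ n i ∧ n i < a i <;> simp [h, mul_add]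
  map_smul' r f := by
    funext n
    by_cases h : 1 ≤ n i ∧ n i < a i <;> simp [h, mul_left_comm]

lemma X_apply (q : Fin c → Fin c → k) (a : Fin c → ℕ) (i : Fin c) (f : (Fin c → ℕ) → k)
    (n : Fin c → ℕ) :
    X q a i f n = if 1 ≤ n i ∧ n i < a i then C q i n * f (n - dl i) else 0 := rfl

lemma X_pow_apply (q : Fin c → Fin c → k) (a : Fin c → ℕ) (i : Fin c) (f : (Fin c → ℕ) → k)
    (m : ℕ) : ∀ (n : Fin c → ℕ), n i < m → (X q a i ^ m) f n = 0 := by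
  induction m with
  | zero => intro n h; omega
  | succ m ih =>
    intro n h
    rw [pow_succ', Module.End.mul_apply, X_apply]
    split_ifs with h1
    · rw [ih, mul_zero]
      simp; omega
    · rfl

lemma X_pow (q : Fin c → Fin c → k) (a : Fin c → ℕ) (ha : ∀ i, 2 ≤ a i) (i : Fin c) :
    X q a i ^ a i = 0 := by
  ext1 f
  funext n
  by_cases h : n i < a i
  · rw [X_pow_apply _ _ _ _ _ _ h]; rfl
  · obtain ⟨b, hb⟩ : ∃ b, a i = b + 1 := ⟨a i - 1, by have := ha i; omega⟩
    rw [hb, pow_succ', Module.End.mul_apply, X_apply, if_neg (by omega)]; rfl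

lemma X_comm (q : Fin c → Fin c → k) (a : Fin c → ℕ)
    (hqd : ∀ i, q i i = 1) (hqc : ∀ i j, q i j * q j i = 1) (i j : Fin c) :
    X q a i * X q a j = q i j • (X q a j * X q a i) := by
  by_cases hij : i = j
  · subst hij; rw [hqd, one_smul]
  ext1 f
  funext n
  have hji : j ≠ i := Ne.symm hij
  simp only [Module.End.mul_apply, LinearMap.smul_apply, Pi.smul_apply, X_apply, smul_eq_mul]
  have e1 : (n - dl i) j = n j := by simp [hji]
  have e2 : (n - dl j) i = n i := by simp [hij]
  rw [e1, e2]
  by_cases h1 : 1 ≤ n i ∧ n i < a i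
  swap
  · simp [h1]
  by_cases h2 : 1 ≤ n j ∧ n j < a j
  swap
  · simp [h2]
  rw [if_pos h1, if_pos h2, if_pos h1, if_pos h2]
  have e3 : n - dl j - dl i = n - dl i - dl j := tsub_right_comm
  rw [e3]
  have ci := C_add q i j (n - dl j)
  have cj := C_add q j i (n - dl i)
  rw [sub_add_dl _ _ h2.1] at ci
  rw [sub_add_dl _ _ h1.1] at cj
  rw [ci, cj]
  rcases lt_or_gt_of_ne hij with h | h
  · rw [if_neg (not_lt.2 h.le), if_pos h]
    linear_combination (-(C q i (n - dl j) * C q j (n - dl i) * f (n - dl i - dl j))) * hqc i j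
  · rw [if_pos h, if_neg (not_lt.2 h.le)]
    ring

variable (q : Fin c → Fin c → k) (a : Fin c → ℕ)

/-- generator -/
def x (i : Fin c) : QCI k c q a := RingQuot.mkAlgHom k (qciRel k c q a) (FreeAlgebra.ι k i)

lemma x_pow (i : Fin c) : x q a i ^ a i = 0 := by
  have := RingQuot.mkAlgHom_rel k (s := qciRel k c q a) (Or.inl ⟨i, rfl, rfl⟩)
  simpa [x] using this

lemma x_comm (i j : Fin c) : x q a i * x q a j = q i j • (x q a j * x q a i) := by
  have := RingQuot.mkAlgHom_rel k (s := qciRel k c q a) (Or.inr ⟨i, j, rfl, rfl⟩)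
  simpa [x] using this

lemma x_comm_pow (i j : Fin c) (m : ℕ) :
    x q a i * x q a j ^ m = q i j ^ m • (x q a j ^ m * x q a i) := by
  induction m with
  | zero => simp
  | succ m ih =>
    rw [pow_succ, ← mul_assoc, ih, smul_mul_assoc, mul_assoc, x_comm, mul_smul_comm, smul_smul,
      pow_succ, mul_assoc]

/-- ordered monomials -/
def mon (n : Fin c → ℕ) : QCI k c q a := ((List.finRange c).map fun i => x q a i ^ n i).prod

lemma x_mul_list (i : Fin c) (n : Fin c → ℕ) (l : List (Fin c)) (hl : l.Pairwise (· < ·))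
    (hi : i ∈ l) :
    x q a i * (l.map fun i => x q a i ^ n i).prod =
      (l.map fun j => if j < i then q i j ^ n j else 1).prod •
        (l.map fun j => x q a j ^ (n + dl i) j).prod := by
  induction l with
  | nil => simp at hi
  | cons j l ih =>
    rw [List.pairwise_cons] at hl
    simp only [List.map_cons, List.prod_cons]
    by_cases hij : i = j
    · subst hij
      have h1 : (l.map fun j => if j < i then q i j ^ n j else 1) = l.map fun _ => 1 :=
        List.map_congr_left fun j hj => if_neg (not_lt.2 (hl.1 j hj).le)
      have h2 : (l.map fun j => x q a j ^ (n + dl i) j) = l.map fun j => x q a j ^ n j :=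
        List.map_congr_left fun j hj => by
          have : j ≠ i := (hl.1 j hj).ne'
          simp [this]
      rw [h1, h2]
      simp [pow_succ', mul_assoc]
    · have hi' : i ∈ l := by simpa [hij] using hi
      have hlt := hl.1 i hi'
      have hji : j ≠ i := Ne.symm hij
      rw [← mul_assoc, x_comm_pow, smul_mul_assoc, mul_assoc, ih hl.2 hi', mul_smul_comm,
        smul_smul, if_pos hlt]
      simp [hji]

lemma x_mul_mon (i : Fin c) (n : Fin c → ℕ) :
    x q a i * mon q a n = C q i n • mon q a (n + dl i) := by
  have := x_mul_list q a i n (List.finRange c) (List.pairwise_lt_finRange c) (List.mem_finRange i)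
  rw [mon, this, C, mon, ← List.prod_ofFn, List.ofFn_eq_map]

lemma mon_zero (n : Fin c → ℕ) (i : Fin c) (h : a i ≤ n i) : mon q a n = 0 := by
  apply List.prod_eq_zero
  refine List.mem_map.2 ⟨i, List.mem_finRange i, ?_⟩
  rw [← Nat.add_sub_cancel' h, pow_add, x_pow, zero_mul]

/-- exponent box -/
def box : Finset (Fin c → ℕ) := Fintype.piFinset fun i => range (a i)

lemma mem_box (n : Fin c → ℕ) : n ∈ box a ↔ ∀ i, n i < a i := by simp [box]

/-- from functions to the algebra -/
def sg (f : (Fin c → ℕ) → k) : QCI k c q a := ∑ n ∈ box a, f n • mon q a n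

lemma sg_X (i : Fin c) (f : (Fin c → ℕ) → k) : sg q a (X q a i f) = x q a i * sg q a f := by
  rw [sg, sg, Finset.mul_sum]
  have hL : ∑ n ∈ box a, X q a i f n • mon q a n =
      ∑ n ∈ (box a).filter (fun n => 1 ≤ n i), X q a i f n • mon q a n := by
    rw [Finset.sum_filter_of_ne]
    intro n hn h
    by_contra h1
    apply h
    rw [X_apply, if_neg (fun h => h1 h.1), zero_smul]
  have hR : ∑ n ∈ box a, x q a i * f n • mon q a n =
      ∑ n ∈ (box a).filter (fun n => n i + 1 < a i), x q a i * f n • mon q a n := by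
    rw [Finset.sum_filter_of_ne]
    intro n hn h
    by_contra h1
    apply h
    rw [mul_smul_comm, x_mul_mon, mon_zero q a _ i (by simp; omega), smul_zero, smul_zero]
  rw [hL, hR]
  refine Finset.sum_nbij' (fun n => n - dl i) (fun n => n + dl i) ?_ ?_ ?_ ?_ ?_
  · intro n hn
    simp only [mem_filter, mem_box] at hn ⊢
    refine ⟨fun j => lt_of_le_of_lt (Nat.sub_le _ _) (hn.1 j), ?_⟩
    have := hn.1 i
    simp; omega
  · intro n hn
    simp only [mem_filter, mem_box] at hn ⊢
    refine ⟨fun j => ?_, by simp⟩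
    by_cases h : j = i
    · subst h; simpa using hn.2
    · simpa [h] using hn.1 j
  · intro n hn
    simp only [mem_filter, mem_box] at hn
    exact sub_add_dl i n hn.2
  · intro n hn
    simp
  · intro n hn
    simp only [mem_filter, mem_box] at hn
    have e := sub_add_dl i n hn.2
    have hc := C_add q i i (n - dl i)
    rw [e, if_neg (lt_irrefl i), mul_one] at hc
    rw [X_apply, if_pos ⟨hn.2, hn.1 i⟩, mul_smul_comm, x_mul_mon, e, smul_smul, hc, mul_comm]

variable (hqd : ∀ i, q i i = 1) (hqc : ∀ i j, q i j * q j i = 1) (ha : ∀ i, 2 ≤ a i)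

/-- the representation -/
def rho (hqd : ∀ i, q i i = 1) (hqc : ∀ i j, q i j * q j i = 1) (ha : ∀ i, 2 ≤ a i) :
    QCI k c q a →ₐ[k] Module.End k ((Fin c → ℕ) → k) :=
  RingQuot.liftAlgHom k ⟨FreeAlgebra.lift k (X q a), by
    rintro u v (⟨i, rfl, rfl⟩ | ⟨i, j, rfl, rfl⟩)
    · simp [X_pow q a ha i]
    · simp [X_comm q a hqd hqc i j]⟩

lemma rho_x (i : Fin c) : rho q a hqd hqc ha (x q a i) = X q a i := by
  simp [rho, x]

lemma sg_add (f g : (Fin c → ℕ) → k) : sg q a (f + g) = sg q a f + sg q a g := by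
  simp [sg, add_smul, Finset.sum_add_distrib]

lemma sg_smul (r : k) (f : (Fin c → ℕ) → k) : sg q a (r • f) = r • sg q a f := by
  simp [sg, Finset.smul_sum, smul_smul]

lemma sg_rho (z : QCI k c q a) : ∀ f, sg q a (rho q a hqd hqc ha z f) = z * sg q a f := by
  obtain ⟨z, rfl⟩ := RingQuot.mkAlgHom_surjective k (qciRel k c q a) z
  induction z using FreeAlgebra.induction with
  | grade0 r =>
    intro f
    rw [AlgHom.commutes, AlgHom.commutes, Module.algebraMap_end_apply, sg_smul, Algebra.smul_def]
  | grade1 i =>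
    intro f
    have := rho_x q a hqd hqc ha i
    rw [x] at this
    rw [this, sg_X, x]
  | mul u v hu hv =>
    intro f
    rw [map_mul, map_mul, Module.End.mul_apply, hu, hv, mul_assoc]
  | add u v hu hv =>
    intro f
    rw [map_add, map_add, LinearMap.add_apply, sg_add, hu, hv, add_mul]

/-- the vector at zero -/
def e0 : (Fin c → ℕ) → k := Pi.single 0 1

lemma sg_e0 (ha : ∀ i, 2 ≤ a i) : sg q a e0 = 1 := by
  rw [sg, Finset.sum_eq_single 0]
  · simp [e0, mon]
  · intro n _ hn
    simp [e0, hn]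
  · intro h
    exact absurd ((mem_box a 0).2 fun i => by have := ha i; simp; omega) h

lemma sg_rho_e0 (z : QCI k c q a) : sg q a (rho q a hqd hqc ha z e0) = z := by
  rw [sg_rho, sg_e0 q a ha, mul_one]

lemma finite_qci (hqd : ∀ i, q i i = 1) (hqc : ∀ i j, q i j * q j i = 1)
    (ha : ∀ i, 2 ≤ a i) : Module.Finite k (QCI k c q a) := by
  classical
  refine ⟨⟨(box a).image (mon q a), ?_⟩⟩
  rw [eq_top_iff]
  intro z _
  rw [← sg_rho_e0 q a hqd hqc ha z, sg]
  refine Submodule.sum_mem _ fun n hn => Submodule.smul_mem _ _ (Submodule.subset_span ?_)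
  exact Finset.mem_coe.2 (Finset.mem_image_of_mem _ hn)

lemma exists_top (N : ℕ) : ∀ (n : Fin c → ℕ) (w : (Fin c → ℕ) → k), n ∈ box a →
    ∑ i, (a i - 1 - n i) = N → w n ≠ 0 →
    ∃ y, rho q a hqd hqc ha y w (fun i => a i - 1) ≠ 0 := by
  induction N with
  | zero =>
    intro n w hn hs hw
    refine ⟨1, ?_⟩
    have : (fun i => a i - 1) = n := by
      funext i
      have h1 := (mem_box a n).1 hn i
      have h2 := (Finset.sum_eq_zero_iff.1 hs) i (mem_univ i)
      omega
    rw [this]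
    simpa using hw
  | succ N ih =>
    intro n w hn hs hw
    obtain ⟨i, -, hi⟩ : ∃ i ∈ (univ : Finset (Fin c)), a i - 1 - n i ≠ 0 := by
      apply Finset.exists_ne_zero_of_sum_ne_zero
      omega
    have hb := (mem_box a n).1 hn
    refine (ih (n + dl i) (X q a i w) ?_ ?_ ?_).elim fun y hy => ⟨y * x q a i, by
      rwa [map_mul, Module.End.mul_apply, rho_x]⟩
    · rw [mem_box]
      intro j
      by_cases h : j = i
      · subst h; simp; omega
      · simpa [h] using hb j
    · have h1 := Finset.add_sum_erase univ (fun j => a j - 1 - n j) (mem_univ i)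
      have h2 := Finset.add_sum_erase univ (fun j => a j - 1 - (n + dl i) j) (mem_univ i)
      have h3 : ∑ j ∈ univ.erase i, (a j - 1 - (n + dl i) j) =
          ∑ j ∈ univ.erase i, (a j - 1 - n j) := by
        refine Finset.sum_congr rfl fun j hj => ?_
        simp [Finset.ne_of_mem_erase hj]
      have h4 : (n + dl i) i = n i + 1 := by simp
      rw [h4] at h2
      omega
    · have h4 : (n + dl i) i = n i + 1 := by simp
      rw [X_apply, h4, if_pos (by omega)]
      simpa using ⟨C_ne q hqc i _, hw⟩

/-- the Frobenius functional -/
def phi : QCI k c q a →ₗ[k] k where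
  toFun z := rho q a hqd hqc ha z e0 (fun i => a i - 1)
  map_add' u v := by simp
  map_smul' r u := by simp

lemma phi_nondeg (b : QCI k c q a) (h : ∀ y, phi q a hqd hqc ha (y * b) = 0) : b = 0 := by
  by_contra hb
  rw [← sg_rho_e0 q a hqd hqc ha b, sg] at hb
  obtain ⟨n, hn, hne⟩ := Finset.exists_ne_zero_of_sum_ne_zero hb
  obtain ⟨y, hy⟩ := exists_top q a hqd hqc ha _ n (rho q a hqd hqc ha b e0) hn rfl
    (fun h => hne (by rw [h, zero_smul]))
  apply hy
  have := h y
  simpa [phi] using this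

lemma baer_of_frob {A : Type} [Ring A] [Algebra k A] [Module.Finite k A] (φ : A →ₗ[k] k)
    (hφ : ∀ b, (∀ y, φ (y * b) = 0) → b = 0) : Module.Injective A A := by
  apply Module.Baer.injective
  intro I g
  let T : A →ₗ[k] Module.Dual k A := (LinearMap.mul k A).flip.compr₂ φ
  have hT : ∀ b y, T b y = φ (y * b) := fun b y => rfl
  have hinj : Function.Injective T := by
    rw [injective_iff_map_eq_zero]
    intro b hb
    refine hφ b fun y => ?_
    rw [← hT, hb]; rfl
  have hsurj : Function.Surjective T :=
    (LinearMap.injective_iff_surjective_of_finrank_eq_finrank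
      (Subspace.dual_finrank_eq (K := k) (V := A)).symm).1 hinj
  obtain ⟨ψ, hψ⟩ := LinearMap.exists_extend (p := I.restrictScalars k)
    (φ ∘ₗ (g.restrictScalars k : I.restrictScalars k →ₗ[k] A))
  obtain ⟨b, hb⟩ := hsurj ψ
  refine ⟨LinearMap.toSpanSingleton A A b, fun z hz => ?_⟩
  rw [LinearMap.toSpanSingleton_apply, smul_eq_mul, ← sub_eq_zero]
  refine hφ _ fun y => ?_
  have h1 : ψ (y * z) = φ (g ⟨y * z, I.mul_mem_left y hz⟩) :=
    LinearMap.congr_fun hψ (⟨y * z, I.mul_mem_left y hz⟩ : I.restrictScalars k)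
  have h2 : g ⟨y * z, I.mul_mem_left y hz⟩ = y * g ⟨z, hz⟩ := by
    rw [← smul_eq_mul y (g ⟨z, hz⟩), ← map_smul]; rfl
  rw [← hb, hT, h2] at h1
  rw [mul_sub, map_sub, ← mul_assoc, h1, sub_self]

end QCIAux

theorem qci_selfinjective
    (k : Type) [Field k] (c : ℕ) (hc : 1 ≤ c)
    (q : Fin c → Fin c → k) (a : Fin c → ℕ)
    (hqd : ∀ i, q i i = 1) (hqc : ∀ i j, q i j * q j i = 1) (ha : ∀ i, 2 ≤ a i) :
    Module.Injective (QCI k c q a) (QCI k c q a) := by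
  have := QCIAux.finite_qci q a hqd hqc ha
  exact QCIAux.baer_of_frob (QCIAux.phi q a hqd hqc ha) (QCIAux.phi_nondeg q a hqd hqc ha)
end
end
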